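/- arXiv:1903.01793 — 8 statements merged into one kernel-verified Lean document; each statement's English description precedes it below -/
import Mathlib

section
/- Let τ ∈ ℝ, μ = iτ, and δ > 0. Define f_δ(x,v) = (1/δ)·exp(−μ x/v − x²) for 0 < |v| < δ and f_δ(x,v) = 0 for |v| ≥ δ. Then: (i) ∫∫ (1+|v|)|f_δ(x,v)| dx dv = (2+δ)√π; (ii) ∫∫ (1+|v|)·|v ∂f_δ/∂x (x,v) + μ f_δ(x,v)| dx dv = 2δ(1 + 2δ/3); (iii) ∫ |∫_{−δ}^{δ} v f_δ(x,v) dv| dx ≤ 2δ. -/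
open MeasureTheory Complex Real Set

lemma aux_even (δ : ℝ) (hδ : 0 < δ) (g : ℝ → ℝ) :
    (∫ v : ℝ, if 0 < |v| ∧ |v| < δ then g |v| else 0) = 2 * ∫ r in (0:ℝ)..δ, g r := by
  have h := integral_comp_abs (f := fun r : ℝ => if 0 < r ∧ r < δ then g r else 0)
  rw [h]
  congr 1
  rw [intervalIntegral.integral_of_le hδ.le, integral_Ioc_eq_integral_Ioo,
    ← integral_indicator measurableSet_Ioi, ← integral_indicator measurableSet_Ioo]
  congr 1
  ext r
  by_cases h1 : 0 < r <;> by_cases h2 : r < δ <;> simp [indicator, h1, h2]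

lemma aux_gauss : (∫ x : ℝ, Real.exp (-x ^ 2)) = Real.sqrt π := by
  have := integral_gaussian 1
  simpa using this

lemma aux_gauss1 : (∫ x : ℝ, |x| * Real.exp (-x ^ 2)) = 1 := by
  have h := integral_comp_abs (f := fun r : ℝ => r * Real.exp (-r ^ 2))
  simp only [sq_abs] at h
  rw [h]
  have h2 := integral_mul_cexp_neg_mul_sq (b := 1) (by simp)
  have h3 : (∫ r : ℝ in Ioi 0, (r : ℂ) * cexp (-1 * (r:ℂ) ^ 2))
      = ((∫ r in Ioi (0:ℝ), r * Real.exp (-r ^ 2) : ℝ) : ℂ) := by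
    rw [← integral_complex_ofReal]
    congr 1
    ext r
    push_cast
    simp
  rw [h3] at h2
  have h4 : (∫ r in Ioi (0:ℝ), r * Real.exp (-r ^ 2)) = 2⁻¹ := by
    apply Complex.ofReal_injective
    rw [h2]; push_cast; simp
  rw [h4]; norm_num

lemma aux_norm (τ δ x v : ℝ) (hδ : 0 < δ) :
    ‖(1 / (δ : ℂ)) * Complex.exp (-(Complex.I * τ) * x / v - x ^ 2)‖
      = 1 / δ * Real.exp (-x ^ 2) := by
  rw [norm_mul, Complex.norm_exp]
  have h : (-(Complex.I * τ) * x / v - (x:ℂ) ^ 2) = ((-x^2 : ℝ) : ℂ) + ((-τ * x / v : ℝ) : ℂ) * I := by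
    push_cast; ring
  rw [h, Complex.add_re, Complex.re_ofReal_mul]
  simp only [Complex.ofReal_re, Complex.I_re, mul_zero, add_zero]
  simp [abs_of_pos hδ]

/-- The explicit computations on the approximate-eigenvector family
`f_δ(x,v) = δ⁻¹ exp(-μx/v - x²)` (for `0 < |v| < δ`, `μ = iτ`) showing that the
imaginary axis lies in the spectrum of the free transport operator `A = -v ∂/∂x` on
`L¹(ℝ_x × ℝ_v, (1+|v|) dx dv)`, and that `C f = ∫ v f dv` is small on this family. -/
theorem approximate_eigenvector_computations (τ δ : ℝ) (hδ : 0 < δ)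
    (μ : ℂ) (hμ : μ = Complex.I * τ)
    (f : ℝ → ℝ → ℂ)
    (hf : ∀ x v : ℝ, f x v =
      if 0 < |v| ∧ |v| < δ then (1 / (δ : ℂ)) * Complex.exp (-μ * x / v - x ^ 2) else 0) :
    (∫ v : ℝ, ∫ x : ℝ, (1 + |v|) * ‖f x v‖) = (2 + δ) * Real.sqrt π ∧
    (∫ v : ℝ, ∫ x : ℝ, (1 + |v|) * ‖(v : ℂ) * deriv (fun y => f y v) x + μ * f x v‖) =
      2 * δ * (1 + 2 * δ / 3) ∧
    (∫ x : ℝ, ‖∫ v in Ioo (-δ) δ, (v : ℂ) * f x v‖) ≤ 2 * δ := by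
  subst hμ
  have hn : ∀ x v : ℝ, ‖f x v‖ =
      if 0 < |v| ∧ |v| < δ then 1 / δ * Real.exp (-x ^ 2) else 0 := by
    intro x v
    rw [hf]
    split_ifs
    · exact aux_norm τ δ x v hδ
    · simp
  have i2 : ∫ r in (0:ℝ)..δ, r = δ ^ 2 / 2 := by simp
  have i3 : ∫ r in (0:ℝ)..δ, r ^ 2 = δ ^ 3 / 3 := by rw [integral_pow]; norm_num
  refine ⟨?_, ?_, ?_⟩
  · have h1 : ∀ v : ℝ, (∫ x : ℝ, (1 + |v|) * ‖f x v‖) =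
        if 0 < |v| ∧ |v| < δ then (fun r => (1 + r) * (1 / δ * √π)) |v| else 0 := by
      intro v
      simp only [hn]
      split_ifs
      · rw [integral_const_mul, integral_const_mul, aux_gauss]
      · simp
    simp only [h1]
    rw [aux_even δ hδ (fun r => (1 + r) * (1 / δ * √π)), intervalIntegral.integral_mul_const,
      intervalIntegral.integral_add (by simp) (by simp), i2]
    simp
    field_simp
  · have h1 : ∀ v : ℝ, (∫ x : ℝ, (1 + |v|) * ‖(v : ℂ) * deriv (fun y => f y v) x
          + (I * τ) * f x v‖) =
        if 0 < |v| ∧ |v| < δ then (fun r => (2 / δ) * (r + r ^ 2)) |v| else 0 := by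
      intro v
      by_cases hv : 0 < |v| ∧ |v| < δ
      · have hv0 : (v : ℂ) ≠ 0 := by
          exact_mod_cast abs_pos.mp hv.1
        have h2 : ∀ x : ℝ, (1 + |v|) * ‖(v : ℂ) * deriv (fun y => f y v) x
          + (I * τ) * f x v‖ = ((2 / δ) * (|v| + |v| ^ 2)) * (|x| * Real.exp (-x ^ 2)) := by
          intro x
          have hd : HasDerivAt (fun y => f y v)
              (f x v * (-(I * τ) / v - 2 * x)) x := by
            have e : (fun y => f y v) = fun y : ℝ =>
                (1 / (δ : ℂ)) * Complex.exp (-(I * τ) * y / v - (y:ℂ) ^ 2) := by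
              ext y; rw [hf, if_pos hv]
            rw [e, hf, if_pos hv]
            have hy : HasDerivAt (fun y : ℝ => (y : ℂ)) 1 x := Complex.ofRealCLM.hasDerivAt
            have := ((((hy.const_mul (-(I * τ))).div_const (v:ℂ)).sub (hy.pow 2)).cexp).const_mul
              (1 / (δ : ℂ))
            refine this.congr_deriv ?_
            simp only [Pi.sub_apply, Pi.pow_apply]
            push_cast
            ring
          rw [hd.deriv]
          have e2 : (v : ℂ) * (f x v * (-(I * τ) / v - 2 * x)) + I * τ * f x v
              = ((-2 * x * v : ℝ) : ℂ) * f x v := by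
            push_cast; field_simp; ring
          rw [e2, norm_mul, hn, if_pos hv, Complex.norm_real, Real.norm_eq_abs, abs_mul, abs_mul]
          rw [show |(-2:ℝ)| = 2 by norm_num]
          ring
        simp only [h2]
        rw [integral_const_mul, aux_gauss1, if_pos hv]
        simp
      · have h2 : ∀ y, f y v = 0 := by
          intro y; rw [hf, if_neg hv]
        rw [if_neg hv]
        simp [h2]
    simp only [h1]
    rw [aux_even δ hδ (fun r => (2 / δ) * (r + r ^ 2)), intervalIntegral.integral_const_mul,
      intervalIntegral.integral_add (by simp) (by simp), i2, i3]
    field_simp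
  · have hI : ∫ v in Ioo (-δ) δ, |v| = δ ^ 2 := by
      have := aux_even δ hδ (fun r => r)
      rw [i2] at this
      rw [← integral_indicator measurableSet_Ioo]
      trans 2 * (δ ^ 2 / 2)
      · rw [← this]
        congr 1
        ext v
        by_cases h0 : v = 0
        · simp [h0]
        · simp [indicator, abs_lt, h0]
      · ring
    have hb : ∀ x : ℝ, ‖∫ v in Ioo (-δ) δ, (v : ℂ) * f x v‖ ≤ δ * Real.exp (-x ^ 2) := by
      intro x
      have : ‖∫ v in Ioo (-δ) δ, (v : ℂ) * f x v‖ ≤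
          ∫ v in Ioo (-δ) δ, |v| * (1 / δ * Real.exp (-x ^ 2)) := by
        apply norm_integral_le_of_norm_le
        · exact ((continuous_abs.mul continuous_const).integrableOn_Icc).mono_set Ioo_subset_Icc_self
        · refine Filter.Eventually.of_forall fun v => ?_
          rw [norm_mul, hn, Complex.norm_real, Real.norm_eq_abs]
          split_ifs
          · exact le_rfl
          · rw [mul_zero]; positivity
      refine this.trans (le_of_eq ?_)
      rw [integral_mul_const, hI]
      field_simp
    have hg : Integrable (fun x : ℝ => Real.exp (-x ^ 2)) := by
      simpa using integrable_exp_neg_mul_sq (b := 1) one_pos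
    calc _ ≤ ∫ x : ℝ, δ * Real.exp (-x ^ 2) :=
          integral_mono_of_nonneg (Filter.Eventually.of_forall fun x => norm_nonneg _)
            (hg.const_mul δ) (Filter.Eventually.of_forall hb)
      _ = δ * √π := by rw [integral_const_mul, aux_gauss]
      _ ≤ δ * 2 := by
          gcongr
          rw [Real.sqrt_le_left (by norm_num)]
          linarith [Real.pi_le_four]
      _ = 2 * δ := by ring
end

section
/- Let λ ∈ ℂ with σ = Re λ > 0, let φ : ℝ → ℝ satisfy ∫ |v||φ(v)| dv < ∞, and let g ∈ L¹(ℝ, ℂ). Define Q(λ)g(x) = (1/λ)·[ ∫_{−∞}^0 φ(v) ( ∫_x^∞ exp(λ(ξ−x)/v) g(ξ) dξ ) dv − ∫_0^∞ φ(v) ( ∫_{−∞}^x exp(λ(ξ−x)/v) g(ξ) dξ ) dv ]. Then ∫ |Q(λ)g(x)| dx ≤ (1/(|λ| σ)) · ( ∫ |φ(v)||v| dv ) · ( ∫ |g(ξ)| dξ ). -/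
open MeasureTheory Complex Set

noncomputable def kerK (s v t : ℝ) : ENNReal :=
  if v * t < 0 then ENNReal.ofReal (Real.exp (s * t / v)) else 0

lemma kerK_meas (s : ℝ) {α : Type*} [MeasurableSpace α] {a b : α → ℝ} (ha : Measurable a)
    (hb : Measurable b) : Measurable (fun z => kerK s (a z) (b z)) := by
  unfold kerK
  refine Measurable.ite (measurableSet_lt (ha.mul hb) measurable_const) ?_ measurable_const
  exact (Real.measurable_exp.comp ((hb.const_mul s).div ha)).ennreal_ofReal

lemma kerK_int (s v : ℝ) (hs : 0 < s) : ∫⁻ t, kerK s v t ≤ ENNReal.ofReal (|v| / s) := by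
  rcases lt_trichotomy v 0 with hv | hv | hv
  · have h1 : ∀ t, kerK s v t = (Ioi (0:ℝ)).indicator
        (fun t => ENNReal.ofReal (Real.exp (s / v * t))) t := by
      intro t
      by_cases ht : 0 < t
      · have : v * t < 0 := mul_neg_of_neg_of_pos hv ht
        simp [kerK, this, ht]
        ring_nf
      · have : ¬ v * t < 0 := not_lt.2 (mul_nonneg_of_nonpos_of_nonpos hv.le (not_lt.1 ht))
        simp [kerK, this, ht]
    have ha : s / v < 0 := div_neg_of_pos_of_neg hs hv
    simp_rw [h1]
    rw [lintegral_indicator measurableSet_Ioi,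
      ← ofReal_integral_eq_lintegral_ofReal (integrableOn_exp_mul_Ioi ha 0)
        (ae_of_all _ fun _ => (Real.exp_pos _).le), integral_exp_mul_Ioi ha 0, abs_of_neg hv]
    apply le_of_eq
    congr 1
    simp [neg_div]
  · subst hv
    simp [kerK]
  · have h1 : ∀ t, kerK s v t = (Iio (0:ℝ)).indicator
        (fun t => ENNReal.ofReal (Real.exp (s / v * t))) t := by
      intro t
      by_cases ht : t < 0
      · have : v * t < 0 := mul_neg_of_pos_of_neg hv ht
        simp [kerK, this, ht]
        ring_nf
      · have : ¬ v * t < 0 := not_lt.2 (mul_nonneg hv.le (not_lt.1 ht))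
        simp [kerK, this, ht]
    have ha : 0 < s / v := div_pos hs hv
    simp_rw [h1]
    rw [lintegral_indicator measurableSet_Iio, Measure.restrict_congr_set Iio_ae_eq_Iic,
      ← ofReal_integral_eq_lintegral_ofReal (integrableOn_exp_mul_Iic ha 0)
        (ae_of_all _ fun _ => (Real.exp_pos _).le), integral_exp_mul_Iic ha 0, abs_of_pos hv]
    apply le_of_eq
    congr 1
    simp

lemma kerK_norm (l : ℂ) (v x ξ : ℝ) (h : v * (ξ - x) < 0) (z : ℂ) :
    ‖Complex.exp (l * (ξ - x) / v) * z‖ₑ = kerK l.re v (ξ - x) * ‖z‖ₑ := by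
  rw [enorm_mul, kerK, if_pos h, ← ofReal_norm, Complex.norm_exp]
  congr 4
  rw [Complex.div_ofReal_re, ← Complex.ofReal_sub, Complex.re_mul_ofReal]

lemma kerK_main (s : ℝ) (hs : 0 < s) (p h : ℝ → ENNReal) (hp : Measurable p) (hh : Measurable h) :
    ∫⁻ x, ∫⁻ v, p v * ∫⁻ ξ, kerK s v (ξ - x) * h ξ ≤
      (∫⁻ v, p v * ENNReal.ofReal (|v| / s)) * ∫⁻ ξ, h ξ := by
  have m3 : Measurable (fun q : (ℝ × ℝ) × ℝ => kerK s q.1.2 (q.2 - q.1.1) * h q.2) :=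
    (kerK_meas s (by fun_prop) (by fun_prop)).mul (hh.comp measurable_snd)
  have m2 : Measurable (fun q : ℝ × ℝ => ∫⁻ ξ, kerK s q.2 (ξ - q.1) * h ξ) :=
    m3.lintegral_prod_right'
  rw [lintegral_lintegral_swap ((hp.comp measurable_snd).mul m2).aemeasurable,
    ← lintegral_mul_const _ (by fun_prop)]
  refine lintegral_mono fun v => ?_
  have m1 : Measurable (fun x : ℝ => ∫⁻ ξ, kerK s v (ξ - x) * h ξ) :=
    m2.comp (measurable_id.prodMk measurable_const)
  rw [lintegral_const_mul _ m1, mul_assoc]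
  gcongr
  rw [lintegral_lintegral_swap ((kerK_meas s measurable_const (by fun_prop)).mul
    (hh.comp measurable_snd)).aemeasurable, ← lintegral_const_mul _ hh]
  refine lintegral_mono fun ξ => ?_
  rw [lintegral_mul_const _ (kerK_meas s measurable_const (by fun_prop)),
    lintegral_sub_left_eq_self (fun t => kerK s v t) ξ]
  gcongr
  exact kerK_int s v hs

/-- The norm bound
`‖Q(λ)g‖_{L¹} ≤ (|λ| Re λ)⁻¹ (∫|φ(v)||v| dv) ‖g‖_{L¹}` for the Schur-complement
operator `Q(λ) = λ⁻¹ C (A-λ)⁻¹ B` of the linearized Vlasov system, `Re λ > 0`. -/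
theorem Q_operator_L1_bound (l : ℂ) (hl : 0 < l.re)
    (φ : ℝ → ℝ) (hφm : Measurable φ)
    (hφ : Integrable (fun v => |v| * |φ v|))
    (g : ℝ → ℂ) (hg : Integrable g)
    (Q : ℝ → ℂ)
    (hQ : ∀ x, Q x = (1 / l) *
      ((∫ v in Iio (0 : ℝ), (φ v : ℂ) *
          ∫ ξ in Ioi x, Complex.exp (l * (ξ - x) / v) * g ξ) -
       (∫ v in Ioi (0 : ℝ), (φ v : ℂ) *
          ∫ ξ in Iio x, Complex.exp (l * (ξ - x) / v) * g ξ))) :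
    (∫⁻ x : ℝ, ENNReal.ofReal ‖Q x‖) ≤
      ENNReal.ofReal ((1 / (‖l‖ * l.re)) * (∫ v : ℝ, |φ v| * |v|) * (∫ ξ : ℝ, ‖g ξ‖)) := by
  obtain ⟨G, hGm, hG⟩ := hg.1
  have hGm' : Measurable G := hGm.measurable
  have hl0 : l ≠ 0 := by rintro rfl; simp at hl
  set F : ℝ → ℝ → ENNReal := fun x v => ‖φ v‖ₑ * ∫⁻ ξ, kerK l.re v (ξ - x) * ‖G ξ‖ₑ with hF
  have key : ∀ (x : ℝ) (v : ℝ) (S : Set ℝ), MeasurableSet S → (∀ ξ ∈ S, v * (ξ - x) < 0) →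
      ‖(φ v : ℂ) * ∫ ξ in S, Complex.exp (l * (ξ - x) / v) * g ξ‖ₑ ≤ F x v := by
    intro x v S hS h
    rw [enorm_mul]
    have e : ‖(φ v : ℂ)‖ₑ = ‖φ v‖ₑ := by
      rw [← ofReal_norm, ← ofReal_norm, Complex.norm_real]
    rw [e]
    simp only [hF]
    gcongr
    refine (enorm_integral_le_lintegral_enorm _).trans ?_
    refine le_trans ?_ (setLIntegral_le_lintegral S _)
    refine lintegral_mono_ae ?_
    filter_upwards [ae_restrict_of_ae hG, ae_restrict_mem hS] with ξ h1 h2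
    rw [h1, kerK_norm l v x ξ (h ξ h2)]
  have bound : ∀ x, ENNReal.ofReal ‖Q x‖ ≤ ‖1 / l‖ₑ * ∫⁻ v, F x v := by
    intro x
    rw [hQ x, ofReal_norm, enorm_mul]
    gcongr
    refine enorm_sub_le.trans ?_
    have hd : Disjoint (Iio (0:ℝ)) (Ioi 0) := by
      rw [Set.disjoint_left]; intro a h1 h2; exact lt_asymm (mem_Iio.1 h1) (mem_Ioi.1 h2)
    refine le_trans ?_ (setLIntegral_le_lintegral (Iio (0:ℝ) ∪ Ioi 0) _)
    rw [lintegral_union measurableSet_Ioi hd]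
    refine add_le_add ?_ ?_
    · refine (enorm_integral_le_lintegral_enorm _).trans ?_
      refine setLIntegral_mono' measurableSet_Iio fun v hv => ?_
      exact key x v _ measurableSet_Ioi fun ξ hξ => mul_neg_of_neg_of_pos hv (sub_pos.2 hξ)
    · refine (enorm_integral_le_lintegral_enorm _).trans ?_
      refine setLIntegral_mono' measurableSet_Ioi fun v hv => ?_
      exact key x v _ measurableSet_Iio fun ξ hξ => mul_neg_of_pos_of_neg hv (sub_neg.2 hξ)
  have hn : ‖1 / l‖ₑ ≠ ⊤ := enorm_ne_top
  refine (lintegral_mono bound).trans ?_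
  rw [lintegral_const_mul' _ _ hn]
  have h2 := kerK_main l.re hl (fun v => ‖φ v‖ₑ) (fun ξ => ‖G ξ‖ₑ) hφm.enorm hGm'.enorm
  refine (mul_le_mul_right h2 _).trans (le_of_eq ?_)
  have e1 : ∫⁻ ξ, ‖G ξ‖ₑ = ENNReal.ofReal (∫ ξ, ‖g ξ‖) := by
    rw [ofReal_integral_norm_eq_lintegral_enorm hg]
    refine lintegral_congr_ae ?_
    filter_upwards [hG] with ξ h
    rw [h]
  have hφ' : Integrable (fun v => |φ v| * |v|) := by simpa only [mul_comm] using hφ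
  have e2 : ∫⁻ v, ‖φ v‖ₑ * ENNReal.ofReal (|v| / l.re) =
      ENNReal.ofReal ((∫ v, |φ v| * |v|) / l.re) := by
    rw [← integral_div, ofReal_integral_eq_lintegral_ofReal (hφ'.div_const _)
      (ae_of_all _ fun v => by positivity)]
    refine lintegral_congr fun v => ?_
    rw [← ofReal_norm, ← ENNReal.ofReal_mul (norm_nonneg _), Real.norm_eq_abs, mul_div_assoc]
  have p1 : 0 ≤ ∫ v, |φ v| * |v| := integral_nonneg fun v => by positivity
  rw [e1, e2, ← ofReal_norm, ← ENNReal.ofReal_mul (by positivity),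
    ← ENNReal.ofReal_mul (norm_nonneg _), norm_div, norm_one]
  congr 1
  field_simp
end

section
/- Let φ : ℝ → ℝ satisfy ∫ (1+|v|)|φ(v)| dv < ∞ and ∫ φ(v) dv = 0, and let λ ∈ ℂ with Re λ ≠ 0. Then for every k ∈ ℝ with k ≠ 0, |Δ(k,λ) − 1| ≤ (1/(|λ| |Re λ|)) · ∫ |v||φ(v)| dv. In particular, if |Re λ| > (1/|λ|) ∫ |v||φ(v)| dv, then Δ(k,λ) ≠ 0 for every k ≠ 0. -/
open MeasureTheory Complex

/-- The Landau dispersion function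
`Δ(k,λ) = 1 + (1/(ik)) ∫ φ(v)/(ikv + λ) dv`. -/
noncomputable def Landau (φ : ℝ → ℝ) (k : ℝ) (l : ℂ) : ℂ :=
  1 + (1 / (Complex.I * k)) * ∫ v : ℝ, (φ v : ℂ) / (Complex.I * k * v + l)

/-- Proposition 1. For `∫ φ = 0` and `Re λ ≠ 0` one has
`|Δ(k,λ) - 1| ≤ (|λ| |Re λ|)⁻¹ ∫ |v||φ(v)| dv` for all `k ≠ 0`; in particular if
`|Re λ| > |λ|⁻¹ ∫ |v||φ(v)| dv` then `Δ(k,λ) ≠ 0` for every `k ≠ 0`. -/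
theorem Landau_sub_one_bound (φ : ℝ → ℝ)
    (hφ : Integrable (fun v => (1 + |v|) * |φ v|)) (hφm : Measurable φ)
    (hφ0 : (∫ v : ℝ, φ v) = 0)
    (l : ℂ) (hl : l.re ≠ 0) :
    (∀ k : ℝ, k ≠ 0 →
      ‖Landau φ k l - 1‖ ≤ (1 / (‖l‖ * |l.re|)) * ∫ v : ℝ, |v| * |φ v|) ∧
    ((1 / ‖l‖) * (∫ v : ℝ, |v| * |φ v|) < |l.re| →
      ∀ k : ℝ, k ≠ 0 → Landau φ k l ≠ 0) := by
  have hlne : l ≠ 0 := by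
    rintro rfl
    simp at hl
  have hln : 0 < ‖l‖ := norm_pos_iff.mpr hlne
  have hre : 0 < |l.re| := abs_pos.mpr hl
  have hφi : Integrable φ := by
    refine hφ.mono' hφm.aestronglyMeasurable (Filter.Eventually.of_forall fun v => ?_)
    rw [Real.norm_eq_abs]
    nlinarith [abs_nonneg v, abs_nonneg (φ v), mul_nonneg (abs_nonneg v) (abs_nonneg (φ v))]
  have hvi : Integrable (fun v : ℝ => |v| * |φ v|) := by
    refine hφ.mono' (by fun_prop) (Filter.Eventually.of_forall fun v => ?_)
    rw [Real.norm_eq_abs, abs_of_nonneg (mul_nonneg (abs_nonneg v) (abs_nonneg (φ v)))]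
    nlinarith [abs_nonneg (φ v)]
  have hb : ∀ k : ℝ, k ≠ 0 →
      ‖Landau φ k l - 1‖ ≤ (1 / (‖l‖ * |l.re|)) * ∫ v : ℝ, |v| * |φ v| := by
    intro k hk
    have hkc : (k : ℂ) ≠ 0 := by exact_mod_cast hk
    have hden : ∀ v : ℝ, |l.re| ≤ ‖Complex.I * k * v + l‖ := by
      intro v
      have := Complex.abs_re_le_norm (Complex.I * k * v + l)
      simpa using this
    have hdne : ∀ v : ℝ, Complex.I * k * v + l ≠ 0 := fun v =>
      norm_pos_iff.mp (hre.trans_le (hden v))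
    have hci : Integrable (fun v : ℝ => (φ v : ℂ)) := hφi.ofReal
    have hi1 : Integrable (fun v : ℝ => (φ v : ℂ) / (Complex.I * k * v + l)) := by
      refine (hφi.norm.div_const |l.re|).mono' ?_ (Filter.Eventually.of_forall fun v => ?_)
      · exact Measurable.aestronglyMeasurable (by fun_prop)
      · rw [norm_div, Complex.norm_real]
        exact div_le_div_of_nonneg_left (norm_nonneg _) hre (hden v)
    have hi2 : Integrable (fun v : ℝ => (φ v : ℂ) / l) := hci.div_const l
    have h0 : ∫ v : ℝ, (φ v : ℂ) / l = 0 := by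
      rw [integral_div, integral_complex_ofReal, hφ0]
      simp
    have hE : Landau φ k l - 1 = ∫ v : ℝ, -((v : ℂ) * φ v) / (l * (Complex.I * k * v + l)) := by
      have h1 : ∫ v : ℝ, (φ v : ℂ) / (Complex.I * k * v + l)
          = ∫ v : ℝ, ((φ v : ℂ) / (Complex.I * k * v + l) - (φ v : ℂ) / l) := by
        rw [integral_sub hi1 hi2, h0, sub_zero]
      unfold Landau
      rw [h1, add_sub_cancel_left, ← integral_const_mul]
      congr 1
      funext v
      have := hdne v
      have hI := Complex.I_ne_zero
      rw [div_sub_div _ _ this hlne, div_mul_div_comm, div_eq_div_iff (by positivity) (by positivity)]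
      ring
    rw [hE, ← integral_const_mul]
    refine norm_integral_le_of_norm_le (hvi.const_mul _) (Filter.Eventually.of_forall fun v => ?_)
    rw [norm_div, norm_neg, norm_mul, norm_mul, Complex.norm_real, Complex.norm_real,
      Real.norm_eq_abs, Real.norm_eq_abs, one_div_mul_eq_div]
    exact div_le_div_of_nonneg_left (by positivity) (by positivity)
      (mul_le_mul_of_nonneg_left (hden v) hln.le)
  refine ⟨hb, fun h k hk h0 => ?_⟩
  have h1 := hb k hk
  rw [h0, zero_sub, norm_neg, norm_one, one_div_mul_eq_div, le_div_iff₀ (by positivity)] at h1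
  rw [one_div_mul_eq_div, div_lt_iff₀ hln] at h
  linarith
end

section
/- Let λ ∈ ℂ with Re λ > 0, let φ : ℝ → ℝ satisfy ∫ (1+|v|)|φ(v)| dv < ∞ and ∫ φ(v) dv = 0, and let g ∈ L¹(ℝ, ℂ). Define Q(λ)g(x) = (1/λ)·[ ∫_{−∞}^0 φ(v) ( ∫_x^∞ exp(λ(ξ−x)/v) g(ξ) dξ ) dv − ∫_0^∞ φ(v) ( ∫_{−∞}^x exp(λ(ξ−x)/v) g(ξ) dξ ) dv ]. Then Q(λ)g is integrable and for every k ≠ 0 its Fourier transform satisfies 𝓕(g + Q(λ)g)(k) = Δ(k,λ) · 𝓕g(k), where 𝓕h(k) = (2π)^{−1/2} ∫ e^{−ikx} h(x) dx. -/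
open MeasureTheory Complex Set

/-- The Fourier transform `𝓕h(k) = (2π)^{-1/2} ∫ e^{-ikx} h(x) dx`. -/
noncomputable def FT (h : ℝ → ℂ) (k : ℝ) : ℂ :=
  (1 / (Real.sqrt (2 * Real.pi)) : ℂ) * ∫ x : ℝ, Complex.exp (-Complex.I * k * x) * h x

noncomputable def KK (l : ℂ) (v s : ℝ) : ℂ :=
  if v < 0 then (Ioi (0:ℝ)).indicator (fun s : ℝ => Complex.exp (l * s / v)) s
  else if 0 < v then -(Iio (0:ℝ)).indicator (fun s : ℝ => Complex.exp (l * s / v)) s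
  else 0

theorem KK_meas (l : ℂ) : Measurable (fun p : ℝ × ℝ => KK l p.1 p.2) := by
  unfold KK
  simp only [indicator, mem_Ioi, mem_Iio]
  have he : Measurable (fun p : ℝ × ℝ => Complex.exp (l * p.2 / p.1)) := by fun_prop
  refine Measurable.ite (measurableSet_lt measurable_fst measurable_const) ?_
    (Measurable.ite (measurableSet_lt measurable_const measurable_fst) ?_ measurable_const)
  · exact Measurable.ite (measurableSet_lt measurable_const measurable_snd) he measurable_const
  · exact (Measurable.ite (measurableSet_lt measurable_snd measurable_const) he measurable_const).neg

theorem KK_exp_neg (l : ℂ) (k v : ℝ) (hv : v < 0) :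
    (fun s : ℝ => Complex.exp (I * k * s) * KK l v s) =
      (Ioi (0:ℝ)).indicator (fun s : ℝ => Complex.exp ((I * k + l / v) * s)) := by
  funext s
  simp only [KK, hv, if_true, indicator]
  split_ifs
  · rw [← Complex.exp_add]; congr 1; ring
  · simp

theorem KK_exp_pos (l : ℂ) (k v : ℝ) (hv : 0 < v) :
    (fun s : ℝ => Complex.exp (I * k * s) * KK l v s) =
      (Iio (0:ℝ)).indicator (fun s : ℝ => - Complex.exp ((I * k + l / v) * s)) := by
  funext s
  simp only [KK, hv, not_lt.2 hv.le, if_true, if_false, indicator]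
  split_ifs
  · rw [mul_neg, ← Complex.exp_add]; congr 2; ring
  · simp

theorem re_aux (l : ℂ) (k v : ℝ) : (I * k + l / v).re = l.re / v := by
  simp [Complex.div_ofReal_re]

theorem KK_integrable (l : ℂ) (hl : 0 < l.re) (k v : ℝ) (hv : v ≠ 0) :
    Integrable (fun s : ℝ => Complex.exp (I * k * s) * KK l v s) := by
  rcases lt_or_gt_of_ne hv with h | h
  · rw [KK_exp_neg l k v h, integrable_indicator_iff measurableSet_Ioi]
    exact integrableOn_exp_mul_complex_Ioi (by rw [re_aux]; exact div_neg_of_pos_of_neg hl h) 0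
  · rw [KK_exp_pos l k v h, integrable_indicator_iff measurableSet_Iio]
    exact ((integrableOn_exp_mul_complex_Iic
      (by rw [re_aux]; exact div_pos hl h) 0).mono_set Iio_subset_Iic_self).neg

theorem den_ne (l : ℂ) (hl : 0 < l.re) (k v : ℝ) : I * k * v + l ≠ 0 := by
  intro h
  have := congrArg Complex.re h
  simp at this
  exact hl.ne' this

theorem KK_integral (l : ℂ) (hl : 0 < l.re) (k v : ℝ) (hv : v ≠ 0) :
    ∫ s : ℝ, Complex.exp (I * k * s) * KK l v s = - v / (I * k * v + l) := by
  have hvc : (v : ℂ) ≠ 0 := by exact_mod_cast hv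
  have hd := den_ne l hl k v
  have hq : I * k + l / v = (I * k * v + l) / v := by field_simp
  rcases lt_or_gt_of_ne hv with h | h
  · rw [KK_exp_neg l k v h, integral_indicator measurableSet_Ioi,
      integral_exp_mul_complex_Ioi (by rw [re_aux]; exact div_neg_of_pos_of_neg hl h) 0, hq]
    simp [neg_div]
  · rw [KK_exp_pos l k v h, integral_indicator measurableSet_Iio, integral_neg,
      ← integral_Iic_eq_integral_Iio,
      integral_exp_mul_complex_Iic (by rw [re_aux]; exact div_pos hl h) 0, hq]
    simp [neg_div]

theorem KK_norm_integral (l : ℂ) (hl : 0 < l.re) (v : ℝ) (hv : v ≠ 0) :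
    ∫ s : ℝ, ‖KK l v s‖ = |v| / l.re := by
  rcases lt_or_gt_of_ne hv with h | h
  · have : (fun s : ℝ => ‖KK l v s‖) =
      (Ioi (0:ℝ)).indicator (fun s : ℝ => Real.exp ((l.re / v) * s)) := by
      funext s
      simp only [KK, h, if_true, indicator]
      split_ifs
      · rw [Complex.norm_exp, Complex.div_ofReal_re]; congr 1; simp; ring
      · simp
    rw [this, integral_indicator measurableSet_Ioi,
      integral_exp_mul_Ioi (div_neg_of_pos_of_neg hl h) 0, abs_of_neg h]
    simp [neg_div]
  · have : (fun s : ℝ => ‖KK l v s‖) =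
      (Iio (0:ℝ)).indicator (fun s : ℝ => Real.exp ((l.re / v) * s)) := by
      funext s
      simp only [KK, h, not_lt.2 h.le, if_true, if_false, indicator]
      split_ifs
      · rw [norm_neg, Complex.norm_exp, Complex.div_ofReal_re]; congr 1; simp; ring
      · simp
    rw [this, integral_indicator measurableSet_Iio, ← integral_Iic_eq_integral_Iio,
      integral_exp_mul_Iic (div_pos hl h) 0, abs_of_pos h]
    simp

noncomputable def FF (l : ℂ) (φ : ℝ → ℝ) (g : ℝ → ℂ) (p : ℝ × (ℝ × ℝ)) : ℂ :=
  (φ p.2.1 : ℂ) * (KK l p.2.1 (p.2.2 - p.1) * g p.2.2)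

theorem ae_ne : ∀ᵐ y : ℝ × ℝ, y.1 ≠ 0 :=
  Measure.quasiMeasurePreserving_fst.ae (Measure.ae_ne volume (0:ℝ))

theorem FF_integrable (l : ℂ) (hl : 0 < l.re) (φ : ℝ → ℝ) (hφm : Measurable φ)
    (hφ : Integrable (fun v => (1 + |v|) * |φ v|)) (g : ℝ → ℂ) (hg : Integrable g) :
    Integrable (FF l φ g) (volume.prod volume) := by
  have hm : AEStronglyMeasurable (FF l φ g) (volume.prod volume) := by
    unfold FF
    refine AEStronglyMeasurable.mul ?_ (AEStronglyMeasurable.mul ?_ ?_)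
    · exact Measurable.aestronglyMeasurable (by fun_prop)
    · have : Measurable (fun p : ℝ × (ℝ × ℝ) => (p.2.1, p.2.2 - p.1)) := by fun_prop
      exact ((KK_meas l).comp this).aestronglyMeasurable
    · exact (hg.1.comp_snd (μ := (volume : Measure ℝ))).comp_snd
  rw [integrable_prod_iff' hm]
  constructor
  · filter_upwards [ae_ne] with y hy
    have := (KK_integrable l hl 0 y.1 hy).comp_sub_left y.2
    simp only [ofReal_zero, mul_zero, zero_mul, Complex.exp_zero, one_mul] at this
    exact (this.mul_const (g y.2)).const_mul (φ y.1 : ℂ)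
  · have h1 : Integrable (fun v : ℝ => |φ v| * (|v| / l.re)) := by
      have : Integrable (fun v : ℝ => |v| * |φ v|) := by
        refine hφ.mono (by fun_prop) (Filter.Eventually.of_forall fun v => ?_)
        rw [norm_mul, norm_mul]
        gcongr
        simp only [Real.norm_eq_abs, abs_abs]
        rw [abs_of_nonneg (by positivity : 0 ≤ 1 + |v|)]
        linarith
      refine (this.div_const l.re).congr (Filter.Eventually.of_forall fun v => ?_)
      simp only; ring
    refine (h1.mul_prod hg.norm).congr ?_
    filter_upwards [ae_ne] with y hy
    simp only [FF, norm_mul]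
    rw [integral_const_mul, integral_mul_const,
      integral_sub_left_eq_self (fun s => ‖KK l y.1 s‖) volume y.2, KK_norm_integral l hl _ hy]
    simp; ring

theorem Q_eq (l : ℂ) (φ : ℝ → ℝ) (g : ℝ → ℂ) (x : ℝ)
    (h : Integrable (fun y => FF l φ g (x, y))) :
    ((∫ v in Iio (0 : ℝ), (φ v : ℂ) *
          ∫ ξ in Ioi x, Complex.exp (l * (ξ - x) / v) * g ξ) -
       (∫ v in Ioi (0 : ℝ), (φ v : ℂ) *
          ∫ ξ in Iio x, Complex.exp (l * (ξ - x) / v) * g ξ)) = ∫ y, FF l φ g (x, y) := by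
  have h' : Integrable (fun y : ℝ × ℝ => FF l φ g (x, y)) (volume.prod volume) := h
  have hi := h'.integral_prod_left
  have e : ∫ y, FF l φ g (x, y) = ∫ v : ℝ, ∫ ξ : ℝ, FF l φ g (x, (v, ξ)) := integral_prod _ h'
  rw [e, ← integral_add_compl measurableSet_Iio hi (s := Iio 0), compl_Iio,
    integral_Ici_eq_integral_Ioi, sub_eq_add_neg, ← integral_neg]
  congr 1
  · refine setIntegral_congr_fun measurableSet_Iio fun v hv => ?_
    simp only [FF]
    rw [integral_const_mul, ← integral_indicator measurableSet_Ioi]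
    congr 2; funext ξ
    simp only [KK, show v < 0 from hv, if_true, indicator, mem_Ioi, sub_pos]
    split_ifs <;> simp
  · refine setIntegral_congr_fun measurableSet_Ioi fun v hv => ?_
    have hv' : 0 < v := hv
    simp only [FF]
    rw [integral_const_mul, ← integral_indicator measurableSet_Iio, ← mul_neg, ← integral_neg]
    congr 2; funext ξ
    simp only [KK, hv', not_lt.2 hv'.le, if_true, if_false, indicator, mem_Iio, sub_neg]
    split_ifs <;> simp

theorem FT_FF (l : ℂ) (hl : 0 < l.re) (φ : ℝ → ℝ) (hφm : Measurable φ)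
    (hφ : Integrable (fun v => (1 + |v|) * |φ v|)) (g : ℝ → ℂ) (hg : Integrable g) (k : ℝ) :
    ∫ x : ℝ, Complex.exp (-I * k * x) * ∫ y, FF l φ g (x, y) =
      (∫ v : ℝ, (φ v : ℂ) * (-v / (I * k * v + l))) * ∫ ξ : ℝ, Complex.exp (-I * k * ξ) * g ξ := by
  have e0 : ∀ x : ℝ, Complex.exp (-I * k * x) * ∫ y, FF l φ g (x, y) =
      ∫ y, Complex.exp (-I * k * x) * FF l φ g (x, y) := fun x => (integral_const_mul _ _).symm
  rw [integral_congr_ae (Filter.Eventually.of_forall e0), integral_integral_swap (f := fun (x : ℝ) (y : ℝ × ℝ) =>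
    Complex.exp (-I * k * x) * FF l φ g (x, y)), ← integral_prod_mul]
  · refine integral_congr_ae ?_
    filter_upwards [ae_ne] with y hy
    rw [← KK_integral l hl k y.1 hy, ← integral_sub_left_eq_self _ volume y.2,
      ← integral_const_mul, ← integral_mul_const]
    congr 1; funext x
    simp only [FF]
    have : Complex.exp (-I * k * ((y.2 - x : ℝ) : ℂ)) =
        Complex.exp (I * k * x) * Complex.exp (-I * k * y.2) := by
      rw [← Complex.exp_add]; congr 1; push_cast; ring
    rw [sub_sub_cancel, this]; ring
  · refine (FF_integrable l hl φ hφm hφ g hg).bdd_mul (c := 1)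
      (f := fun p : ℝ × (ℝ × ℝ) => Complex.exp (-I * k * p.1)) ?_ ?_
    · exact Measurable.aestronglyMeasurable (by fun_prop)
    · refine Filter.Eventually.of_forall fun p => ?_
      rw [Complex.norm_exp]; simp

/-- Proposition 2. In Fourier representation the normalized Schur
complement `J + Q(λ)` acts as multiplication by the Landau dispersion function:
`𝓕(g + Q(λ)g)(k) = Δ(k,λ) 𝓕g(k)` for `k ≠ 0`. -/
theorem fourier_schur_complement (l : ℂ) (hl : 0 < l.re)
    (φ : ℝ → ℝ) (hφm : Measurable φ)
    (hφ : Integrable (fun v => (1 + |v|) * |φ v|))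
    (hφ0 : (∫ v : ℝ, φ v) = 0)
    (g : ℝ → ℂ) (hg : Integrable g)
    (Q : ℝ → ℂ)
    (hQ : ∀ x, Q x = (1 / l) *
      ((∫ v in Iio (0 : ℝ), (φ v : ℂ) *
          ∫ ξ in Ioi x, Complex.exp (l * (ξ - x) / v) * g ξ) -
       (∫ v in Ioi (0 : ℝ), (φ v : ℂ) *
          ∫ ξ in Iio x, Complex.exp (l * (ξ - x) / v) * g ξ))) :
    Integrable Q ∧
      ∀ k : ℝ, k ≠ 0 →
        FT (fun x => g x + Q x) k = Landau φ k l * FT g k := by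
  have hF := FF_integrable l hl φ hφm hφ g hg
  have hQe : Q =ᵐ[volume] fun x => (1 / l) * ∫ y, FF l φ g (x, y) := by
    filter_upwards [hF.prod_right_ae] with x hx
    rw [hQ x, Q_eq l φ g x hx]
  have hQi : Integrable Q := (hF.integral_prod_left.const_mul (1 / l)).congr hQe.symm
  refine ⟨hQi, fun k hk => ?_⟩
  have hbd : ∀ h : ℝ → ℂ, Integrable h →
      Integrable (fun x : ℝ => Complex.exp (-I * k * x) * h x) := fun h hh => by
    refine hh.bdd_mul (c := 1) (Measurable.aestronglyMeasurable (by fun_prop)) ?_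
    refine Filter.Eventually.of_forall fun p => ?_
    rw [Complex.norm_exp]; simp
  have hl0 : l ≠ 0 := by rintro rfl; simp at hl
  have hkc : (k : ℂ) ≠ 0 := by exact_mod_cast hk
  have h1 : ∫ x : ℝ, Complex.exp (-I * k * x) * Q x =
      (1 / l) * ((∫ v : ℝ, (φ v : ℂ) * (-v / (I * k * v + l))) *
        ∫ ξ : ℝ, Complex.exp (-I * k * ξ) * g ξ) := by
    rw [← FT_FF l hl φ hφm hφ g hg k, ← integral_const_mul]
    refine integral_congr_ae ?_
    filter_upwards [hQe] with x hx
    rw [hx]; ring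
  have hφi : Integrable φ := by
    refine hφ.mono (by fun_prop) (Filter.Eventually.of_forall fun v => ?_)
    rw [Real.norm_eq_abs, Real.norm_eq_abs,
      abs_of_nonneg (by positivity : 0 ≤ (1 + |v|) * |φ v|)]
    nlinarith [mul_nonneg (abs_nonneg v) (abs_nonneg (φ v))]
  have hφc : Integrable (fun v => (φ v : ℂ)) := hφi.ofReal
  have hφd : Integrable (fun v : ℝ => (φ v : ℂ) / (I * k * v + l)) := by
    refine (hφc.bdd_mul (c := 1 / l.re) (f := fun v : ℝ => (I * k * v + l)⁻¹)
      (Measurable.aestronglyMeasurable (by fun_prop)) ?_).congr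
      (Filter.Eventually.of_forall fun v => ?_)
    · refine Filter.Eventually.of_forall fun v => ?_
      rw [norm_inv, ← one_div]
      refine one_div_le_one_div_of_le hl ?_
      refine le_trans (le_of_eq ?_) (Complex.re_le_norm _)
      simp
    · simp only; ring
  have h0 : ∫ v : ℝ, (φ v : ℂ) = 0 := by
    have := integral_ofReal (μ := volume) (𝕜 := ℂ) (f := φ)
    rw [hφ0] at this
    simpa using this
  have h2 : ∫ v : ℝ, (φ v : ℂ) * (-v / (I * k * v + l)) =
      (l / (I * k)) * ∫ v : ℝ, (φ v : ℂ) / (I * k * v + l) := by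
    have : ∀ v : ℝ, (φ v : ℂ) * (-v / (I * k * v + l)) =
        (l / (I * k)) * ((φ v : ℂ) / (I * k * v + l)) - (1 / (I * k)) * (φ v : ℂ) := fun v => by
      have hd := den_ne l hl k v
      have hI := Complex.I_ne_zero
      generalize hD : I * k * v + l = D at hd ⊢
      rw [show l = D - I * k * v by rw [← hD]; ring]
      field_simp
      ring
    simp_rw [this]
    rw [integral_sub (hφd.const_mul _) (hφc.const_mul _), integral_const_mul, integral_const_mul,
      h0]
    simp
  unfold FT Landau
  simp_rw [mul_add]
  rw [integral_add (hbd g hg) (hbd Q hQi), h1, h2]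
  field_simp
end

section
/- Let φ : ℝ → ℝ be differentiable with bounded derivative and integrable on ℝ, and let s ∈ ℝ with φ(s) = 0. Then | ∫_ℝ φ(v)/(v−s) dv | ≤ 2√2 · ( sup_v |φ′(v)| )^{1/2} · ( ∫_ℝ |φ(v)| dv )^{1/2}. -/
open MeasureTheory

theorem pv_aux (φ : ℝ → ℝ) (M : ℝ) (hM : 0 ≤ M) (s : ℝ)
    (hl : ∀ v, |φ v| ≤ M * |v - s|)
    (hint : Integrable φ) (ε : ℝ) (hε : 0 < ε) :
    |∫ v : ℝ, φ v / (v - s)| ≤ 2 * ε * M + (∫ v : ℝ, |φ v|) / ε := by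
  have h1 : Integrable (Set.indicator (Set.Icc (s - ε) (s + ε)) (fun _ : ℝ => M)) := by
    rw [integrable_indicator_iff measurableSet_Icc]
    exact integrableOn_const (by simp)
  have h2 : Integrable (fun v => |φ v| / ε) := hint.abs.div_const ε
  have h3 := norm_integral_le_of_norm_le (f := fun v => φ v / (v - s)) (h1.add h2)
    (Filter.Eventually.of_forall (fun v => by
      simp only [Pi.add_apply, Real.norm_eq_abs, abs_div]
      by_cases hv : v ∈ Set.Icc (s - ε) (s + ε)
      · rw [Set.indicator_of_mem hv]
        have : |φ v| / |v - s| ≤ M := div_le_of_le_mul₀ (abs_nonneg _) hM (hl v)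
        have : 0 ≤ |φ v| / ε := by positivity
        linarith
      · rw [Set.indicator_of_notMem hv, zero_add]
        have : ε ≤ |v - s| := by
          by_contra! h
          rw [abs_lt] at h
          exact hv ⟨by linarith, by linarith⟩
        gcongr))
  rw [Real.norm_eq_abs] at h3
  refine h3.trans (le_of_eq ?_)
  simp only [Pi.add_apply]
  rw [integral_add h1 h2, integral_indicator measurableSet_Icc, integral_div]
  simp
  left
  rw [max_eq_left (by linarith)]
  ring

/-- core estimate of Lemma 4. If `φ` is differentiable with bounded
derivative, integrable, and `φ(s) = 0`, then
`|∫ φ(v)/(v-s) dv| ≤ 2√2 (sup |φ'|)^{1/2} (∫|φ|)^{1/2}`. -/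
theorem principal_value_bound (φ : ℝ → ℝ) (hd : Differentiable ℝ φ)
    (hbd : BddAbove (Set.range fun v => |deriv φ v|))
    (hint : Integrable φ) (s : ℝ) (hs : φ s = 0) :
    |∫ v : ℝ, φ v / (v - s)| ≤
      2 * Real.sqrt 2 * Real.sqrt (⨆ v : ℝ, |deriv φ v|) *
        Real.sqrt (∫ v : ℝ, |φ v|) := by
  have hb : ∀ v, |deriv φ v| ≤ ⨆ v : ℝ, |deriv φ v| := fun v => le_ciSup hbd v
  have hM : 0 ≤ ⨆ v : ℝ, |deriv φ v| := (abs_nonneg _).trans (hb 0)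
  have hI : 0 ≤ ∫ v : ℝ, |φ v| := integral_nonneg fun v => abs_nonneg _
  have hl : ∀ v, |φ v| ≤ (⨆ v : ℝ, |deriv φ v|) * |v - s| := fun v => by
    have := Convex.norm_image_sub_le_of_norm_deriv_le (f := φ) (s := Set.univ) (x := s) (y := v)
      (fun x _ => hd x) (fun x _ => hb x) convex_univ trivial trivial
    simpa [hs] using this
  have key := pv_aux φ _ hM s hl hint
  generalize (⨆ v : ℝ, |deriv φ v|) = M at *
  generalize (∫ v : ℝ, |φ v|) = I at *
  generalize |∫ v : ℝ, φ v / (v - s)| = X at *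
  rcases hM.eq_or_lt with rfl | hM
  · simp only [Real.sqrt_zero, mul_zero, zero_mul, zero_add] at *
    by_contra! h
    have := key ((I + 1) / X) (by positivity)
    rw [div_div_eq_mul_div, le_div_iff₀ (by linarith)] at this
    nlinarith
  rcases hI.eq_or_lt with rfl | hI
  · simp only [Real.sqrt_zero, mul_zero, zero_div, add_zero] at *
    by_contra! h
    have := key (X / (4 * M)) (by positivity)
    have e : 2 * (X / (4 * M)) * M = X / 2 := by field_simp; norm_num
    linarith
  have hm := Real.sqrt_pos.2 hM
  have hi := Real.sqrt_pos.2 hI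
  have hr := Real.sqrt_pos.2 (show (0:ℝ) < 2 by norm_num)
  have hm2 := Real.sq_sqrt hM.le
  have hi2 := Real.sq_sqrt hI.le
  have hr2 := Real.sq_sqrt (show (0:ℝ) ≤ 2 by norm_num)
  refine (key (√I / (√2 * √M)) (by positivity)).trans (le_of_eq ?_)
  generalize √M = m at *
  generalize √I = i at *
  generalize √2 = r at *
  rw [← hm2, ← hi2]
  field_simp
  rw [hr2]
  ring
end

section
/- Let φ : ℝ → ℝ be continuously differentiable with bounded derivative, integrable on ℝ, with φ(v) → 0 as v → ±∞, finitely many zeros, every zero nondegenerate (φ(s) = 0 implies φ′(s) ≠ 0). If k ∈ ℝ satisfies k⁴ > 8 · ( sup_v |φ′(v)| ) · ∫_ℝ |φ(v)| dv (in particular k ≠ 0), then there is no λ ∈ ℂ with Re λ > 0 and Δ(k,λ) = 0. -/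
open MeasureTheory Complex Filter

/-- Lemma 4. If `k⁴ > 8 (sup|φ'|) ∫|φ|` then the Landau dispersion
relationship has no roots in the open right half-plane at wave number `k`. -/
theorem no_unstable_roots_large_k (φ : ℝ → ℝ) (hφc : ContDiff ℝ 1 φ)
    (hbd : BddAbove (Set.range fun v => |deriv φ v|))
    (hint : Integrable φ)
    (htop : Tendsto φ atTop (nhds 0)) (hbot : Tendsto φ atBot (nhds 0))
    (hfin : {s : ℝ | φ s = 0}.Finite)
    (hnd : ∀ s : ℝ, φ s = 0 → deriv φ s ≠ 0)
    (k : ℝ)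
    (hk : 8 * (⨆ v : ℝ, |deriv φ v|) * (∫ v : ℝ, |φ v|) < k ^ 4) :
    ∀ l : ℂ, 0 < l.re → Landau φ k l ≠ 0 := by
  intro l hl h0
  set M := ⨆ v : ℝ, |deriv φ v| with hM
  set A := ∫ v : ℝ, |φ v| with hA
  have hM0 : 0 ≤ M := Real.iSup_nonneg fun v => abs_nonneg _
  have hA0 : 0 ≤ A := integral_nonneg fun v => abs_nonneg _
  have hk0 : k ≠ 0 := by
    rintro rfl
    have : 0 ≤ 8 * M * A := by positivity
    norm_num at hk
    linarith
  have hlip : ∀ x y : ℝ, |φ y - φ x| ≤ M * |y - x| := by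
    intro x y
    have := Convex.norm_image_sub_le_of_norm_deriv_le (f := φ) (C := M) (s := Set.univ)
      (x := x) (y := y) (fun z _ => (hφc.differentiable (by norm_num)) z)
      (fun z _ => le_ciSup hbd z) convex_univ trivial trivial
    simpa [Real.norm_eq_abs] using this
  set F : ℝ → ℂ := fun v => (φ v : ℂ) / (Complex.I * k * v + l) with hF
  have hkC : (k : ℂ) ≠ 0 := by exact_mod_cast hk0
  have hJ : ∫ v, F v = -(Complex.I * k) := by
    have h1 : 1 + (1 / (Complex.I * k)) * ∫ v, F v = 0 := h0
    have hIk : Complex.I * (k : ℂ) ≠ 0 := mul_ne_zero Complex.I_ne_zero hkC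
    field_simp at h1
    linear_combination h1
  have hFi : Integrable F := by
    by_contra hn
    rw [integral_undef hn] at hJ
    have hIk : Complex.I * (k : ℂ) ≠ 0 := mul_ne_zero Complex.I_ne_zero hkC
    exact hIk (neg_eq_zero.mp hJ.symm)
  set g : ℝ → ℝ := fun t => k ^ 2 * t / (k ^ 2 * t ^ 2 + l.re ^ 2) with hg
  set x : ℝ := -l.im / k with hx
  have hden : ∀ t : ℝ, 0 < k ^ 2 * t ^ 2 + l.re ^ 2 := fun t => by positivity
  have hFim : ∀ t, -k * (F (t + x)).im = φ (t + x) * g t := by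
    intro t
    have e1 : k * (t + x) + l.im = k * t := by rw [hx]; field_simp; ring
    have e2 : Complex.I * k * ((t + x : ℝ) : ℂ) + l = ⟨l.re, k * t⟩ := by
      apply Complex.ext
      · simp
      · simp [← e1]
    simp only [hF, hg]
    rw [e2, Complex.div_im]
    have := hden t
    have e3 : Complex.normSq ⟨l.re, k * t⟩ = k ^ 2 * t ^ 2 + l.re ^ 2 := by
      simp [Complex.normSq_apply]; ring
    rw [e3]
    simp
    field_simp
  have hi1 : Integrable (fun t => φ (t + x) * g t) := by
    have := ((hFi.comp_add_right x).im).const_mul (-k)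
    refine this.congr (Eventually.of_forall fun t => ?_)
    exact hFim t
  have hval : ∫ t, φ (t + x) * g t = k ^ 2 := by
    simp_rw [← hFim]
    rw [integral_const_mul, integral_add_right_eq_self (fun v => (F v).im) x]
    have : ∫ v, (F v).im = (∫ v, F v).im := integral_im hFi
    rw [this, hJ]
    simp
    ring
  have hgc : Continuous g := by
    apply Continuous.div (by fun_prop) (by fun_prop)
    exact fun t => (hden t).ne'
  have hgt : ∀ t, |g t| * |t| ≤ 1 := by
    intro t
    rw [← abs_mul, hg]
    have e : k ^ 2 * t / (k ^ 2 * t ^ 2 + l.re ^ 2) * t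
        = k ^ 2 * t ^ 2 / (k ^ 2 * t ^ 2 + l.re ^ 2) := by ring
    simp only [e]
    rw [abs_of_nonneg (by positivity), div_le_one (hden t)]
    nlinarith [sq_nonneg l.re]
  have key : ∀ R : ℝ, 0 < R → k ^ 2 ≤ 2 * M * R + A / R := by
    intro R hR
    set o : ℝ → ℝ := (Set.Icc (-R) R).indicator g with ho
    have hoi : Integrable o :=
      (hgc.continuousOn.integrableOn_compact isCompact_Icc).integrable_indicator measurableSet_Icc
    have ho0 : ∫ t, o t = 0 := by
      have h1 : ∫ t, o (-t) = ∫ t, o t := integral_neg_eq_self o volume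
      have h2 : ∀ t, o (-t) = - o t := by
        intro t
        by_cases ht : t ∈ Set.Icc (-R) R
        · have ht' : -t ∈ Set.Icc (-R) R := ⟨by linarith [ht.2], by linarith [ht.1]⟩
          rw [ho, Set.indicator_of_mem ht, Set.indicator_of_mem ht', hg]
          simp only [neg_sq]
          ring
        · have ht' : -t ∉ Set.Icc (-R) R := fun h => ht ⟨by linarith [h.2], by linarith [h.1]⟩
          rw [ho, Set.indicator_of_notMem ht, Set.indicator_of_notMem ht', neg_zero]
      simp_rw [h2] at h1
      rw [integral_neg] at h1
      linarith
    have hsum : ∫ t, (φ (t + x) * g t - φ x * o t) = k ^ 2 := by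
      rw [integral_sub hi1 (hoi.const_mul _), integral_const_mul, ho0, hval]
      ring
    have hb1 : Integrable ((Set.Icc (-R) R).indicator fun _ => M) :=
      (continuous_const.continuousOn.integrableOn_compact isCompact_Icc).integrable_indicator
        measurableSet_Icc
    have hb2 : Integrable (fun t => |φ (t + x)| / R) :=
      ((hint.comp_add_right x).abs).div_const R
    rw [← hsum]
    calc _ ≤ ∫ t, ((Set.Icc (-R) R).indicator (fun _ => M) t + |φ (t + x)| / R) := by
          refine integral_mono (hi1.sub (hoi.const_mul _)) (hb1.add hb2) fun t => ?_
          refine (le_abs_self _).trans ?_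
          by_cases ht : t ∈ Set.Icc (-R) R
          · simp only [ho, Set.indicator_of_mem ht]
            rw [← sub_mul, abs_mul]
            have h1 := hlip x (t + x)
            rw [add_sub_cancel_right] at h1
            have h2 : |φ (t + x) - φ x| * |g t| ≤ M * |t| * |g t| := by gcongr
            have h3 : 0 ≤ |φ (t + x)| / R := by positivity
            have h4 := mul_le_mul_of_nonneg_left (hgt t) hM0
            nlinarith
          · simp only [ho, Set.indicator_of_notMem ht]
            rw [mul_zero, sub_zero, zero_add, abs_mul, div_eq_mul_inv]
            have h1 : R ≤ |t| := by
              by_contra h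
              exact ht (abs_le.mp (not_le.mp h).le)
            gcongr
            rw [← one_div, le_div_iff₀ hR]
            exact (mul_le_mul_of_nonneg_left h1 (abs_nonneg _)).trans (hgt t)
      _ = _ := by
          rw [integral_add hb1 hb2, integral_indicator measurableSet_Icc, integral_div,
            integral_add_right_eq_self (fun v => |φ v|) x]
          simp [hR.le]
          ring
  have hq : ∀ R : ℝ, 0 ≤ 2 * M * (R * R) + (-k ^ 2) * R + A := by
    intro R
    rcases le_or_gt R 0 with h | h
    · have : 0 ≤ k ^ 2 * (-R) := mul_nonneg (sq_nonneg _) (by linarith)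
      have : 0 ≤ 2 * M * (R * R) := by have := mul_self_nonneg R; positivity
      nlinarith
    · have h1 := mul_le_mul_of_nonneg_right (key R h) h.le
      have : (2 * M * R + A / R) * R = 2 * M * (R * R) + A := by field_simp
      linarith
  have := discrim_le_zero hq
  rw [discrim] at this
  nlinarith
end

section
/- Let f₀ : ℝ → ℝ be continuously differentiable, nonnegative, with f₀(v) → 0 as v → ±∞, and set φ = f₀′. Assume ∫ (1+|v|)|φ(v)| dv < ∞, φ′ = f₀″ exists and is bounded, and there is a ∈ ℝ such that φ(v) > 0 for v < a and φ(v) < 0 for v > a (so f₀ has a unique maximum at a). Then for every k ∈ ℝ with k ≠ 0 and every λ ∈ ℂ with Re λ > 0 one has Δ(k,λ) ≠ 0, and moreover Δ(0,λ) = 1 − λ^{−2} ∫ v φ(v) dv ≠ 0 for every λ with Re λ > 0. -/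
open MeasureTheory Complex Filter

/-- A stationary distribution `f₀` with a unique maximum admits no
unstable plasma modes: `Δ(k,λ) ≠ 0` for all `k ≠ 0` and `Re λ > 0`, and also
`Δ(0,λ) = 1 - λ⁻² ∫ vφ(v) dv ≠ 0` for `Re λ > 0`. -/
theorem single_maximum_stability (f₀ : ℝ → ℝ) (hf : ContDiff ℝ 1 f₀)
    (hpos : ∀ v : ℝ, 0 ≤ f₀ v)
    (htop : Tendsto f₀ atTop (nhds 0)) (hbot : Tendsto f₀ atBot (nhds 0))
    (φ : ℝ → ℝ) (hφ : φ = deriv f₀)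
    (hint : Integrable (fun v => (1 + |v|) * |φ v|))
    (hφd : Differentiable ℝ φ)
    (hφbd : ∃ M : ℝ, ∀ v : ℝ, |deriv φ v| ≤ M)
    (a : ℝ) (ha1 : ∀ v : ℝ, v < a → 0 < φ v) (ha2 : ∀ v : ℝ, a < v → φ v < 0) :
    (∀ k : ℝ, k ≠ 0 → ∀ l : ℂ, 0 < l.re → Landau φ k l ≠ 0) ∧
    (∀ l : ℂ, 0 < l.re → 1 - (1 / l ^ 2) * ((∫ v : ℝ, v * φ v : ℝ) : ℂ) ≠ 0) := by
  have hcont : Continuous φ := hφd.continuous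
  have hφi : Integrable φ := by
    refine hint.mono hcont.aestronglyMeasurable (Eventually.of_forall fun v => ?_)
    rw [Real.norm_eq_abs, Real.norm_eq_abs, abs_mul, abs_abs]
    have h1 : (1 : ℝ) ≤ abs (1 + |v|) := by
      rw [abs_of_nonneg (by positivity)]; linarith [abs_nonneg v]
    nlinarith [abs_nonneg (φ v)]
  have hvi : Integrable (fun v => v * φ v) := by
    refine hint.mono (continuous_id.mul hcont).aestronglyMeasurable
      (Eventually.of_forall fun v => ?_)
    rw [Real.norm_eq_abs, Real.norm_eq_abs, abs_mul, abs_mul, abs_abs]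
    have h1 : |v| ≤ abs (1 + |v|) := by
      rw [abs_of_nonneg (by positivity : 0 ≤ 1 + |v|)]; linarith
    nlinarith [abs_nonneg (φ v)]
  have hsign : ∀ v, (v - a) * φ v ≤ 0 := by
    intro v
    rcases lt_trichotomy v a with h | h | h
    · nlinarith [ha1 v h]
    · simp [h]
    · nlinarith [ha2 v h]
  have hzero : ∫ v, φ v = 0 := by
    have := integral_of_hasDerivAt_of_tendsto (f := f₀) (f' := φ) (m := 0) (n := 0)
      (fun x => by
        rw [hφ]
        exact ((hf.differentiable (by norm_num)) x).hasDerivAt) hφi hbot htop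
    simpa using this
  constructor
  · intro k hk l hl hL
    have hN : ∀ v : ℝ, 0 < l.re ^ 2 + (k * v + l.im) ^ 2 := fun v => by positivity
    have hD : ∀ v : ℝ, Complex.I * k * v + l ≠ 0 := by
      intro v h
      have := congrArg Complex.re h
      simp at this
      exact hl.ne' this
    have hre : ∀ v : ℝ, ((φ v : ℂ) / (Complex.I * k * v + l)).re
        = l.re * (φ v / (l.re ^ 2 + (k * v + l.im) ^ 2)) := by
      intro v
      have := (hN v).ne'
      simp [Complex.div_re, Complex.normSq_apply]
      rw [← sq, ← sq]
      field_simp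
    have him : ∀ v : ℝ, ((φ v : ℂ) / (Complex.I * k * v + l)).im
        = - (k * ((v - a) * φ v / (l.re ^ 2 + (k * v + l.im) ^ 2))
          + (k * a + l.im) * (φ v / (l.re ^ 2 + (k * v + l.im) ^ 2))) := by
      intro v
      have := (hN v).ne'
      simp [Complex.div_im, Complex.normSq_apply]
      rw [← sq, ← sq]
      field_simp
      ring
    have hJi : Integrable (fun v : ℝ => (φ v : ℂ) / (Complex.I * k * v + l)) := by
      refine (hφi.norm.div_const l.re).mono' ?_ (Eventually.of_forall fun v => ?_)
      · refine Continuous.aestronglyMeasurable ?_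
        exact Continuous.div (by fun_prop) (by fun_prop) hD
      · rw [norm_div, Complex.norm_real]
        have : l.re ≤ ‖Complex.I * k * v + l‖ := by
          have := Complex.re_le_norm (Complex.I * k * v + l)
          simpa using this
        gcongr
    have hA : Integrable (fun v : ℝ => φ v / (l.re ^ 2 + (k * v + l.im) ^ 2)) := by
      have h := (hJi.re).const_mul (l.re)⁻¹
      refine h.congr (Eventually.of_forall fun v => ?_)
      change (l.re)⁻¹ * ((φ v : ℂ) / (Complex.I * k * v + l)).re = _
      rw [hre, inv_mul_cancel_left₀ hl.ne']
    have hB : Integrable (fun v : ℝ => (v - a) * φ v / (l.re ^ 2 + (k * v + l.im) ^ 2)) := by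
      have h := ((hJi.im.neg).sub (hA.const_mul (k * a + l.im))).const_mul k⁻¹
      refine h.congr (Eventually.of_forall fun v => ?_)
      change k⁻¹ * (-((φ v : ℂ) / (Complex.I * k * v + l)).im - _) = _
      rw [him, neg_neg, add_sub_cancel_right, inv_mul_cancel_left₀ hk]
    have hJ : ∫ v : ℝ, (φ v : ℂ) / (Complex.I * k * v + l) = -(Complex.I * k) := by
      unfold Landau at hL
      have hIk : Complex.I * (k : ℂ) ≠ 0 :=
        mul_ne_zero Complex.I_ne_zero (Complex.ofReal_ne_zero.mpr hk)
      generalize (∫ v : ℝ, (φ v : ℂ) / (Complex.I * k * v + l)) = J at hL ⊢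
      have h3 : (Complex.I * k) * (1 / (Complex.I * k)) = 1 := mul_one_div_cancel hIk
      linear_combination (Complex.I * k) * hL - J * h3
    have h1 : ∫ v : ℝ, φ v / (l.re ^ 2 + (k * v + l.im) ^ 2) = 0 := by
      have h := integral_re hJi
      rw [hJ] at h
      change ∫ v : ℝ, ((φ v : ℂ) / (Complex.I * k * v + l)).re = (-(Complex.I * k)).re at h
      simp_rw [hre] at h
      rw [integral_const_mul] at h
      simpa [hl.ne'] using h
    have h2 : ∫ v : ℝ, (v - a) * φ v / (l.re ^ 2 + (k * v + l.im) ^ 2) = 1 := by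
      have h := integral_im hJi
      rw [hJ] at h
      change ∫ v : ℝ, ((φ v : ℂ) / (Complex.I * k * v + l)).im = (-(Complex.I * k)).im at h
      simp_rw [him] at h
      rw [integral_neg, integral_add (hB.const_mul k) (hA.const_mul _), integral_const_mul,
        integral_const_mul, h1] at h
      simp at h
      exact mul_left_cancel₀ hk (by linarith)
    have h3 : ∫ v : ℝ, (v - a) * φ v / (l.re ^ 2 + (k * v + l.im) ^ 2) ≤ 0 :=
      integral_nonpos fun v => div_nonpos_of_nonpos_of_nonneg (hsign v) (hN v).le
    linarith
  · intro l hl h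
    have hc : ∫ v, v * φ v ≤ 0 := by
      have h1 : ∫ v, (v - a) * φ v ≤ 0 := integral_nonpos hsign
      have h2 : ∫ v, (v - a) * φ v = ∫ v, v * φ v := by
        simp_rw [sub_mul]
        rw [integral_sub hvi (hφi.const_mul a), integral_const_mul, hzero]
        simp
      linarith
    have hl0 : l ≠ 0 := by
      rintro rfl
      simp at hl
    have hsq : l ^ 2 = ((∫ v : ℝ, v * φ v : ℝ) : ℂ) := by
      field_simp at h
      linear_combination h
    generalize (∫ v : ℝ, v * φ v) = c at hc hsq
    have hr := congrArg Complex.re hsq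
    have hi := congrArg Complex.im hsq
    simp [sq] at hr hi
    have : l.im = 0 := by
      have : l.re * l.im = 0 := by linarith
      exact (mul_eq_zero.mp this).resolve_left hl.ne'
    rw [this] at hr
    nlinarith
end

section
/- Let f₀ : ℝ → ℝ be continuously differentiable with f₀(v) → 0 as v → ±∞, and set φ = f₀′. Assume φ is integrable with bounded derivative, and there are a < c < b with φ(v) > 0 on (−∞,a) ∪ (c,b), φ(v) < 0 on (a,c) ∪ (b,∞), f₀(a) = f₀(b) > 0 and f₀(c) = 0. Then for each k ∈ ℝ with k ≠ 0: there exists λ ∈ ℂ with Re λ > 0 and Δ(k,λ) = 0 if and only if ∫_ℝ φ(v)/(v−c) dv > k². -/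
open MeasureTheory Complex Filter

noncomputable def Zf (φ : ℝ → ℝ) (z : ℂ) : ℂ := ∫ v : ℝ, (φ v : ℂ) / ((v : ℂ) - z)

lemma sub_ne_of_im {z : ℂ} (hz : 0 < z.im) (v : ℝ) : (v : ℂ) - z ≠ 0 := by
  intro h
  have := congrArg Complex.im h
  simp at this
  linarith

lemma norm_sub_ge {z : ℂ} (v : ℝ) : z.im ≤ ‖(v : ℂ) - z‖ := by
  have := Complex.abs_im_le_norm ((v : ℂ) - z)
  simp at this
  exact (le_abs_self _).trans this

lemma Zf_integrable {φ : ℝ → ℝ} (hint : Integrable φ) {z : ℂ} (hz : 0 < z.im) :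
    Integrable (fun v : ℝ => (φ v : ℂ) / ((v : ℂ) - z)) := by
  have h1 : Integrable (fun v : ℝ => (φ v : ℂ)) := hint.ofReal
  have hc : Continuous (fun v : ℝ => ((v : ℂ) - z)⁻¹) :=
    Continuous.inv₀ (by fun_prop) (sub_ne_of_im hz)
  have := h1.mul_bdd (c := z.im⁻¹) hc.aestronglyMeasurable (Eventually.of_forall fun v => by
    rw [norm_inv]
    exact inv_anti₀ hz (norm_sub_ge v))
  simpa [div_eq_mul_inv] using this

lemma re_formula (p v : ℝ) (z : ℂ) : ((p : ℂ) / ((v : ℂ) - z)).re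
    = p * (v - z.re) / ((v - z.re) ^ 2 + z.im ^ 2) := by
  rw [Complex.div_re]
  simp [Complex.normSq_apply]
  ring_nf

lemma im_formula (p v : ℝ) (z : ℂ) : ((p : ℂ) / ((v : ℂ) - z)).im
    = p * z.im / ((v - z.re) ^ 2 + z.im ^ 2) := by
  rw [Complex.div_im]
  simp [Complex.normSq_apply]
  ring_nf

lemma re_integrable {φ : ℝ → ℝ} (hint : Integrable φ) {z : ℂ} (hz : 0 < z.im) :
    Integrable (fun v : ℝ => φ v * (v - z.re) / ((v - z.re) ^ 2 + z.im ^ 2)) := by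
  have := (Zf_integrable hint hz).re
  refine this.congr (Eventually.of_forall fun v => ?_)
  exact re_formula _ _ _

lemma im_integrable {φ : ℝ → ℝ} (hint : Integrable φ) {z : ℂ} (hz : 0 < z.im) :
    Integrable (fun v : ℝ => φ v * z.im / ((v - z.re) ^ 2 + z.im ^ 2)) := by
  have := (Zf_integrable hint hz).im
  refine this.congr (Eventually.of_forall fun v => ?_)
  exact im_formula _ _ _

lemma Zf_re {φ : ℝ → ℝ} (hint : Integrable φ) {z : ℂ} (hz : 0 < z.im) :
    (Zf φ z).re = ∫ v : ℝ, φ v * (v - z.re) / ((v - z.re) ^ 2 + z.im ^ 2) := by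
  have := Complex.reCLM.integral_comp_comm (Zf_integrable hint hz)
  rw [Zf]
  simp only [Complex.reCLM_apply] at this
  rw [← this]
  simp only [re_formula]

lemma Zf_im {φ : ℝ → ℝ} (hint : Integrable φ) {z : ℂ} (hz : 0 < z.im) :
    (Zf φ z).im = ∫ v : ℝ, φ v * z.im / ((v - z.re) ^ 2 + z.im ^ 2) := by
  have := Complex.imCLM.integral_comp_comm (Zf_integrable hint hz)
  rw [Zf]
  simp only [Complex.imCLM_apply] at this
  rw [← this]
  simp only [im_formula]

lemma Zf_neg (φ : ℝ → ℝ) (z : ℂ) : Zf (fun v => - φ v) z = - Zf φ z := by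
  simp only [Zf, ← integral_neg]
  congr 1
  ext v
  push_cast
  ring

lemma Zf_conj (φ : ℝ → ℝ) (z : ℂ) :
    Zf φ ((starRingEnd ℂ) z) = (starRingEnd ℂ) (Zf φ z) := by
  simp only [Zf, ← integral_conj]
  congr 1
  ext v
  simp

lemma Zf_landau (φ : ℝ → ℝ) (k : ℝ) (hk : k ≠ 0) (l : ℂ) :
    Landau φ k l = 1 - Zf φ (I * l / k) / k ^ 2 := by
  have hk' : (k : ℂ) ≠ 0 := by exact_mod_cast hk
  have : ∀ v : ℝ, (φ v : ℂ) / (Complex.I * k * v + l)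
      = (1 / (I * k)) * ((φ v : ℂ) / ((v : ℂ) - I * l / k)) := by
    intro v
    have : Complex.I * k * v + l = (I * k) * ((v : ℂ) - I * l / k) := by
      field_simp
      ring_nf
      simp
    rw [this, div_mul_div_comm, one_mul]
  simp only [Landau, Zf, this, integral_const_mul]
  rw [← mul_assoc, div_mul_div_comm]
  have h2 : (I * k) * (I * (k : ℂ)) = - k ^ 2 := by
    ring_nf
    simp
  rw [h2]
  ring

lemma Zf_differentiable {φ : ℝ → ℝ} (hint : Integrable φ) :
    DifferentiableOn ℂ (Zf φ) {z : ℂ | 0 < z.im} := by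
  intro z₀ hz₀
  have hz₀ : 0 < z₀.im := hz₀
  apply DifferentiableAt.differentiableWithinAt
  have him : ∀ z ∈ Metric.ball z₀ (z₀.im / 2), z₀.im / 2 < z.im := by
    intro z hz
    have h1 := Complex.abs_im_le_norm (z - z₀)
    rw [Metric.mem_ball, dist_eq_norm] at hz
    simp at h1
    have := (abs_le.1 (h1.trans hz.le)).1
    have := (abs_lt.1 (h1.trans_lt hz)).1
    linarith
  have hmeas : AEStronglyMeasurable (fun v : ℝ => (φ v : ℂ)) volume :=
    (hint.ofReal (𝕜 := ℂ)).aestronglyMeasurable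
  have key := hasDerivAt_integral_of_dominated_loc_of_deriv_le (μ := volume) (𝕜 := ℂ)
    (F := fun (z : ℂ) (v : ℝ) => (φ v : ℂ) / ((v : ℂ) - z))
    (F' := fun (z : ℂ) (v : ℝ) => (φ v : ℂ) / ((v : ℂ) - z) ^ 2)
    (x₀ := z₀) (s := Metric.ball z₀ (z₀.im / 2))
    (bound := fun v => |φ v| * ((z₀.im / 2) ^ 2)⁻¹)
    (Metric.ball_mem_nhds _ (by positivity)) ?_ (Zf_integrable hint hz₀) ?_ ?_ ?_ ?_
  · exact key.2.differentiableAt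
  · filter_upwards [Metric.ball_mem_nhds z₀ (show 0 < z₀.im / 2 by positivity)] with z hz
    exact (Zf_integrable hint (by linarith [him z hz])).aestronglyMeasurable
  · have hc : Continuous (fun v : ℝ => (((v : ℂ) - z₀) ^ 2)⁻¹) :=
      Continuous.inv₀ (by fun_prop) (fun v => pow_ne_zero 2 (sub_ne_of_im hz₀ v))
    have := hmeas.mul hc.aestronglyMeasurable
    simp only [div_eq_mul_inv]
    exact this
  · refine Eventually.of_forall fun v z hz => ?_
    have h1 := him z hz
    rw [norm_div, norm_pow, Complex.norm_real, Real.norm_eq_abs, div_eq_mul_inv]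
    gcongr
    exact h1.le.trans (norm_sub_ge v)
  · exact hint.abs.mul_const _
  · refine Eventually.of_forall fun v z hz => ?_
    have h1 := him z hz
    have h2 := sub_ne_of_im (show 0 < z.im by linarith) v
    have := (hasDerivAt_const z (φ v : ℂ)).div ((hasDerivAt_const z (v : ℂ)).sub (hasDerivAt_id z)) h2
    have e : (φ v : ℂ) / ((v : ℂ) - z) ^ 2 = (0 * ((v : ℂ) - z) - (φ v : ℂ) * (0 - 1)) / ((v : ℂ) - z) ^ 2 := by
      ring
    rw [e]
    exact this

lemma shift_inv_integrable (x : ℝ) : Integrable (fun v : ℝ => (1 + (v - x) ^ 2)⁻¹) :=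
  integrable_inv_one_add_sq.comp_sub_right x

/-- Poisson kernel positivity. -/
lemma im_pos_near {φ : ℝ → ℝ} (hint : Integrable φ) (hcont : Continuous φ) (x₀ : ℝ)
    (hx : 0 < φ x₀) :
    ∀ᶠ z in nhdsWithin (x₀ : ℂ) {z : ℂ | 0 < z.im}, 0 < (Zf φ z).im := by
  obtain ⟨δ, hδ, hb⟩ := Metric.eventually_nhds_iff.1
    (hcont.continuousAt.eventually_mem (Ioi_mem_nhds (show φ x₀ / 2 < φ x₀ by linarith)))
  set m := φ x₀ / 2 with hm
  have hmpos : 0 < m := by positivity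
  set A := ∫ v, |φ v| with hA
  have hA0 : 0 ≤ A := integral_nonneg fun v => abs_nonneg _
  have hcr : Tendsto (fun z : ℂ => |z.re - x₀|) (nhds (x₀ : ℂ)) (nhds 0) := by
    have : Continuous (fun z : ℂ => |z.re - x₀|) := by fun_prop
    simpa using this.tendsto (x₀ : ℂ)
  have hci : Tendsto (fun z : ℂ => z.im) (nhds (x₀ : ℂ)) (nhds 0) := by
    simpa using Complex.continuous_im.tendsto (x₀ : ℂ)
  have hci2 : Tendsto (fun z : ℂ => z.im * (4 / δ ^ 2) * A) (nhds (x₀ : ℂ)) (nhds 0) := by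
    simpa using (hci.mul_const (4 / δ ^ 2)).mul_const A
  have e1 := hcr.eventually_lt_const (show 0 < δ / 2 by positivity)
  have e2 := hci.eventually_lt_const (show 0 < δ / 2 by positivity)
  have e3 := hci2.eventually_lt_const hmpos
  filter_upwards [self_mem_nhdsWithin, nhdsWithin_le_nhds e1, nhdsWithin_le_nhds e2,
    nhdsWithin_le_nhds e3] with z hz h1 h2 h3
  have hz : 0 < z.im := hz
  rw [Zf_im hint hz]
  set x := z.re
  set y := z.im
  have hi1 : Integrable ((Set.Icc (x - y) (x + y)).indicator (fun _ : ℝ => m / (2 * y))) := by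
    rw [integrable_indicator_iff measurableSet_Icc]
    exact integrableOn_const (by simp)
  have hi2 : Integrable (fun v => y * (4 / δ ^ 2) * |φ v|) := hint.abs.const_mul _
  have hle : ∫ v, ((Set.Icc (x - y) (x + y)).indicator (fun _ : ℝ => m / (2 * y)) v
      - y * (4 / δ ^ 2) * |φ v|) ≤ ∫ v, φ v * y / ((v - x) ^ 2 + y ^ 2) := by
    apply integral_mono (hi1.sub hi2) (im_integrable hint hz)
    intro v
    change (Set.Icc (x - y) (x + y)).indicator (fun _ : ℝ => m / (2 * y)) v
      - y * (4 / δ ^ 2) * |φ v| ≤ φ v * y / ((v - x) ^ 2 + y ^ 2)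
    have hq : 0 < (v - x) ^ 2 + y ^ 2 := by positivity
    have hnn : 0 ≤ y * (4 / δ ^ 2) * |φ v| := by positivity
    by_cases hv : |v - x₀| < δ
    · have hφv : m < φ v := hb (by simpa [Real.dist_eq] using hv)
      by_cases hmem : v ∈ Set.Icc (x - y) (x + y)
      · simp only [Set.indicator_of_mem hmem]
        have : m / (2 * y) ≤ φ v * y / ((v - x) ^ 2 + y ^ 2) := by
          rw [div_le_div_iff₀ (by positivity) hq]
          have h5 : (v - x) ^ 2 ≤ y ^ 2 := by
            apply sq_le_sq' <;> linarith [hmem.1, hmem.2]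
          nlinarith [mul_le_mul_of_nonneg_left h5 hmpos.le, mul_pos (sub_pos.2 hφv) (pow_pos hz 2)]
        linarith
      · simp only [Set.indicator_of_notMem hmem]
        have : 0 ≤ φ v * y / ((v - x) ^ 2 + y ^ 2) := by
          have : 0 < φ v := hmpos.trans hφv
          positivity
        linarith
    · push Not at hv
      have h6 : δ / 2 ≤ |v - x| := by
        have : |v - x₀| ≤ |v - x| + |x - x₀| := abs_sub_le _ _ _
        linarith
      have hnm : v ∉ Set.Icc (x - y) (x + y) := by
        intro hmem
        have : |v - x| ≤ y := abs_le.2 ⟨by linarith [hmem.1], by linarith [hmem.2]⟩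
        linarith
      simp only [Set.indicator_of_notMem hnm]
      have h7 : δ ^ 2 / 4 ≤ (v - x) ^ 2 + y ^ 2 := by
        have : (δ / 2) ^ 2 ≤ |v - x| ^ 2 := by gcongr
        rw [sq_abs] at this
        nlinarith [sq_nonneg y]
      have h8 : |φ v * y / ((v - x) ^ 2 + y ^ 2)| ≤ y * (4 / δ ^ 2) * |φ v| := by
        rw [abs_div, abs_mul, abs_of_pos hz, abs_of_pos hq]
        calc |φ v| * y / ((v - x) ^ 2 + y ^ 2) ≤ |φ v| * y / (δ ^ 2 / 4) := by gcongr
          _ = _ := by field_simp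
      linarith [neg_le_of_abs_le h8]
  rw [integral_sub hi1 hi2, integral_const_mul, integral_indicator measurableSet_Icc] at hle
  have h9 : ∫ v in Set.Icc (x - y) (x + y), m / (2 * y) = m := by
    rw [setIntegral_const]
    simp [measureReal_def]
    rw [ENNReal.toReal_ofReal (by linarith)]
    field_simp
    ring
  rw [h9] at hle
  linarith

lemma odd_zero (x y : ℝ) :
    ∫ v : ℝ, (1 + (v - x) ^ 2)⁻¹ * (v - x) / ((v - x) ^ 2 + y ^ 2) = 0 := by
  rw [integral_sub_right_eq_self (fun t : ℝ => (1 + t ^ 2)⁻¹ * t / (t ^ 2 + y ^ 2)) x]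
  have h := integral_neg_eq_self (fun t : ℝ => (1 + t ^ 2)⁻¹ * t / (t ^ 2 + y ^ 2)) volume
  have h2 : (fun t : ℝ => (1 + (-t) ^ 2)⁻¹ * (-t) / ((-t) ^ 2 + y ^ 2))
      = fun t : ℝ => - ((1 + t ^ 2)⁻¹ * t / (t ^ 2 + y ^ 2)) := by
    ext t
    ring
  rw [h2, integral_neg] at h
  linarith

lemma sing_integrable {φ : ℝ → ℝ} (hint : Integrable φ) (hcont : Continuous φ) {M : ℝ}
    (hL : ∀ u v, |φ u - φ v| ≤ M * |u - v|) (x₀ : ℝ) (h0 : φ x₀ = 0) :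
    Integrable (fun v => φ v / (v - x₀)) := by
  have hM : 0 ≤ M := by
    have := (abs_nonneg _).trans (hL 1 0)
    simpa using this
  refine Integrable.mono' (hint.abs.add ((shift_inv_integrable x₀).const_mul (2 * M))) ?_ ?_
  · exact (hcont.measurable.div (by fun_prop)).aestronglyMeasurable
  · refine Eventually.of_forall fun v => ?_
    change ‖φ v / (v - x₀)‖ ≤ |φ v| + 2 * M * (1 + (v - x₀) ^ 2)⁻¹
    rw [Real.norm_eq_abs, abs_div]
    have h1 := hL v x₀
    rw [h0, sub_zero] at h1
    have hnn : 0 ≤ 2 * M * (1 + (v - x₀) ^ 2)⁻¹ := by positivity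
    rcases le_or_gt 1 |v - x₀| with h | h
    · have := div_le_self (abs_nonneg (φ v)) h
      linarith
    · have h2 : |φ v| / |v - x₀| ≤ M := div_le_of_le_mul₀ (abs_nonneg _) hM h1
      have h3 : M ≤ 2 * M * (1 + (v - x₀) ^ 2)⁻¹ := by
        rw [← div_eq_mul_inv, le_div_iff₀ (by positivity)]
        have : (v - x₀) ^ 2 < 1 := by
          rw [← sq_abs]
          nlinarith [abs_nonneg (v - x₀)]
        nlinarith
      linarith [abs_nonneg (φ v)]

lemma dct_bound {φ : ℝ → ℝ} {M : ℝ} (hM : 0 ≤ M)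
    (hL : ∀ u v, |φ u - φ v| ≤ M * |u - v|) (x₀ : ℝ) (h0 : φ x₀ = 0) (x y v : ℝ)
    (hy : 0 < y) (hx : |x - x₀| ≤ 1) :
    |(φ v - φ x * (1 + (v - x) ^ 2)⁻¹) * (v - x) / ((v - x) ^ 2 + y ^ 2)|
      ≤ |φ v| + 10 * M * (1 + (v - x₀) ^ 2)⁻¹ := by
  have hφx : |φ x| ≤ M := by
    have := hL x x₀
    rw [h0, sub_zero] at this
    nlinarith
  have hvx := hL v x
  have hs : |v - x₀| ≤ |v - x| + 1 := by
    have : |v - x₀| ≤ |v - x| + |x - x₀| := abs_sub_le _ _ _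
    linarith
  have hs0 := abs_nonneg (v - x₀)
  rw [← sq_abs (v - x₀)]
  set s := |v - x₀|
  rw [abs_div, abs_mul, abs_of_pos (show 0 < (v - x) ^ 2 + y ^ 2 by positivity),
    ← sq_abs (v - x)]
  have ht0 := abs_nonneg (v - x)
  set t := |v - x|
  have hq : 0 < t ^ 2 + y ^ 2 := by positivity
  have hη : 0 < (1 + t ^ 2)⁻¹ := by positivity
  have hη1 : (1 + t ^ 2)⁻¹ ≤ 1 := inv_le_one_of_one_le₀ (by nlinarith)
  rcases lt_or_ge t 1 with ht | ht
  · have h1 : |φ v - φ x * (1 + t ^ 2)⁻¹| ≤ 2 * M * t := by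
      have e : φ v - φ x * (1 + t ^ 2)⁻¹ = (φ v - φ x) + φ x * (1 - (1 + t ^ 2)⁻¹) := by ring
      have h2 : 1 - (1 + t ^ 2)⁻¹ ≤ t := by
        have : 1 - (1 + t ^ 2)⁻¹ = t ^ 2 / (1 + t ^ 2) := by
          field_simp
          ring
        rw [this, div_le_iff₀ (by positivity)]
        nlinarith [pow_nonneg ht0 3]
      rw [e]
      refine (abs_add_le _ _).trans ?_
      rw [abs_mul, abs_of_nonneg (show 0 ≤ 1 - (1 + t ^ 2)⁻¹ by linarith)]
      have : |φ x| * (1 - (1 + t ^ 2)⁻¹) ≤ M * t :=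
        mul_le_mul hφx h2 (by linarith) hM
      linarith
    have h3 : |φ v - φ x * (1 + t ^ 2)⁻¹| * t / (t ^ 2 + y ^ 2) ≤ 2 * M := by
      rw [div_le_iff₀ hq]
      have := mul_le_mul_of_nonneg_right h1 ht0
      have : 0 ≤ M * y ^ 2 := by positivity
      nlinarith
    have h4 : 2 * M ≤ 10 * M * (1 + s ^ 2)⁻¹ := by
      rw [← div_eq_mul_inv, le_div_iff₀ (by positivity)]
      have : s ^ 2 ≤ 4 := by nlinarith
      nlinarith
    linarith [abs_nonneg (φ v)]
  · have h1 : |φ v - φ x * (1 + t ^ 2)⁻¹| ≤ |φ v| + M * (1 + t ^ 2)⁻¹ := by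
      refine (abs_sub _ _).trans ?_
      rw [abs_mul, abs_of_pos hη]
      gcongr
    have h2 : |φ v - φ x * (1 + t ^ 2)⁻¹| * t / (t ^ 2 + y ^ 2)
        ≤ |φ v - φ x * (1 + t ^ 2)⁻¹| := by
      rw [div_le_iff₀ hq]
      apply mul_le_mul_of_nonneg_left _ (abs_nonneg _)
      nlinarith
    have h3 : M * (1 + t ^ 2)⁻¹ ≤ 10 * M * (1 + s ^ 2)⁻¹ := by
      rw [← div_eq_mul_inv, ← div_eq_mul_inv, div_le_div_iff₀ (by positivity) (by positivity)]
      have : 1 + s ^ 2 ≤ 10 * (1 + t ^ 2) := by nlinarith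
      nlinarith
    linarith

lemma re_tendsto {φ : ℝ → ℝ} (hint : Integrable φ) (hcont : Continuous φ) {M : ℝ}
    (hL : ∀ u v, |φ u - φ v| ≤ M * |u - v|) (x₀ : ℝ) (h0 : φ x₀ = 0) :
    Tendsto (fun z => (Zf φ z).re) (nhdsWithin (x₀ : ℂ) {z : ℂ | 0 < z.im})
      (nhds (∫ v, φ v / (v - x₀))) := by
  have hM : 0 ≤ M := by
    have := (abs_nonneg _).trans (hL 1 0)
    simpa using this
  have hsplit : ∀ (z : ℂ) (v : ℝ),
      (φ v - φ z.re * (1 + (v - z.re) ^ 2)⁻¹) * (v - z.re) / ((v - z.re) ^ 2 + z.im ^ 2)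
      = φ v * (v - z.re) / ((v - z.re) ^ 2 + z.im ^ 2)
        - φ z.re * ((1 + (v - z.re) ^ 2)⁻¹ * (v - z.re) / ((v - z.re) ^ 2 + z.im ^ 2)) := by
    intro z v
    ring
  have hi : ∀ z : ℂ, 0 < z.im → Integrable (fun v : ℝ =>
      (φ v - φ z.re * (1 + (v - z.re) ^ 2)⁻¹) * (v - z.re) / ((v - z.re) ^ 2 + z.im ^ 2)) := by
    intro z hz
    simp only [hsplit]
    exact (re_integrable hint hz).sub
      ((re_integrable (shift_inv_integrable z.re) hz).const_mul _)
  have heq : ∀ z : ℂ, 0 < z.im → (∫ v : ℝ,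
      (φ v - φ z.re * (1 + (v - z.re) ^ 2)⁻¹) * (v - z.re) / ((v - z.re) ^ 2 + z.im ^ 2))
      = (Zf φ z).re := by
    intro z hz
    simp only [hsplit]
    rw [integral_sub (re_integrable hint hz)
      ((re_integrable (shift_inv_integrable z.re) hz).const_mul _), integral_const_mul,
      odd_zero, Zf_re hint hz]
    ring
  have hmain : Tendsto (fun z : ℂ => ∫ v : ℝ,
      (φ v - φ z.re * (1 + (v - z.re) ^ 2)⁻¹) * (v - z.re) / ((v - z.re) ^ 2 + z.im ^ 2))
      (nhdsWithin (x₀ : ℂ) {z : ℂ | 0 < z.im}) (nhds (∫ v, φ v / (v - x₀))) := by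
    refine tendsto_integral_filter_of_dominated_convergence
      (fun v => |φ v| + 10 * M * (1 + (v - x₀) ^ 2)⁻¹) ?_ ?_ ?_ ?_
    · filter_upwards [self_mem_nhdsWithin] with z hz
      exact (hi z hz).aestronglyMeasurable
    · have hcr : Tendsto (fun z : ℂ => |z.re - x₀|) (nhds (x₀ : ℂ)) (nhds 0) := by
        have : Continuous (fun z : ℂ => |z.re - x₀|) := by fun_prop
        simpa using this.tendsto (x₀ : ℂ)
      filter_upwards [self_mem_nhdsWithin,
        nhdsWithin_le_nhds (hcr.eventually_lt_const one_pos)] with z hz h1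
      refine Eventually.of_forall fun v => ?_
      exact dct_bound hM hL x₀ h0 _ _ v hz h1.le
    · exact hint.abs.add ((shift_inv_integrable x₀).const_mul (10 * M))
    · have hne : ∀ᵐ v : ℝ, v ≠ x₀ := by
        simp [ae_iff]
      filter_upwards [hne] with v hv
      apply tendsto_nhdsWithin_of_tendsto_nhds
      have hv' : v - x₀ ≠ 0 := sub_ne_zero.2 hv
      have hc : ContinuousAt (fun z : ℂ => (φ v - φ z.re * (1 + (v - z.re) ^ 2)⁻¹) * (v - z.re)
          / ((v - z.re) ^ 2 + z.im ^ 2)) (x₀ : ℂ) := by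
        apply ContinuousAt.div
        · apply Continuous.continuousAt
          have : Continuous (fun z : ℂ => (1 + (v - z.re) ^ 2)⁻¹) :=
            Continuous.inv₀ (by fun_prop) (fun z => by positivity)
          fun_prop
        · fun_prop
        · simp [hv']
      have := hc.tendsto
      convert this using 2
      simp [h0]
      field_simp
  refine hmain.congr' ?_
  filter_upwards [self_mem_nhdsWithin] with z hz
  exact heq z hz

lemma integral_nonpos_at_max {f φ : ℝ → ℝ} (hd : ∀ v, HasDerivAt f (φ v) v)
    (htop : Tendsto f atTop (nhds 0)) (hbot : Tendsto f atBot (nhds 0)) (a : ℝ)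
    (hmax : ∀ v, f v ≤ f a) (hi : Integrable (fun v => φ v / (v - a))) :
    ∫ v, φ v / (v - a) ≤ 0 := by
  have hcf : Continuous f := continuous_iff_continuousAt.2 fun v => (hd v).continuousAt
  set h := dslope f a with hh
  have hc : Continuous h := by
    rw [continuous_iff_continuousAt]
    intro v
    rcases eq_or_ne v a with rfl | hv
    · exact continuousAt_dslope_same.2 (hd v).differentiableAt
    · exact (continuousAt_dslope_of_ne hv).2 hcf.continuousAt
  have hval : ∀ v, v ≠ a → h v = (f v - f a) / (v - a) := by
    intro v hv
    rw [hh, dslope_of_ne _ hv, slope_def_field]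
  have hderiv : ∀ v, v ≠ a → HasDerivAt h ((φ v * (v - a) - (f v - f a) * 1) / (v - a) ^ 2) v := by
    intro v hv
    have h1 : HasDerivAt (fun v => (f v - f a) / (v - a))
        ((φ v * (v - a) - (f v - f a) * 1) / (v - a) ^ 2) v :=
      ((hd v).sub_const (f a)).div ((hasDerivAt_id v).sub_const a) (sub_ne_zero.2 hv)
    refine h1.congr_of_eventuallyEq ?_
    filter_upwards [eventually_ne_nhds hv] with w hw
    exact hval w hw
  have hineq : ∀ v, v ≠ a → φ v / (v - a) ≤ (φ v * (v - a) - (f v - f a) * 1) / (v - a) ^ 2 := by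
    intro v hv
    have hv' : v - a ≠ 0 := sub_ne_zero.2 hv
    have : (φ v * (v - a) - (f v - f a) * 1) / (v - a) ^ 2
      = φ v / (v - a) + (f a - f v) / (v - a) ^ 2 := by
      field_simp
      ring
    rw [this]
    have : 0 ≤ (f a - f v) / (v - a) ^ 2 := div_nonneg (by linarith [hmax v]) (by positivity)
    linarith
  have hinv_top : Tendsto (fun v : ℝ => v - a) atTop atTop := tendsto_atTop_add_const_right _ _ tendsto_id
  have hinv_bot : Tendsto (fun v : ℝ => v - a) atBot atBot := tendsto_atBot_add_const_right _ _ tendsto_id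
  have ht : Tendsto h atTop (nhds 0) := by
    have := (htop.sub_const (f a)).div_atTop hinv_top
    refine this.congr' ?_
    filter_upwards [eventually_gt_atTop a] with v hv
    exact (hval v hv.ne').symm
  have hb : Tendsto h atBot (nhds 0) := by
    have := (hbot.sub_const (f a)).div_atBot hinv_bot
    refine this.congr' ?_
    filter_upwards [eventually_lt_atBot a] with v hv
    exact (hval v hv.ne).symm
  have hlim := intervalIntegral_tendsto_integral hi tendsto_neg_atTop_atBot
    (tendsto_id (α := ℝ) (x := atTop))
  have hlim2 : Tendsto (fun R : ℝ => h R - h (-R)) atTop (nhds 0) := by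
    simpa using ht.sub (hb.comp tendsto_neg_atTop_atBot)
  refine le_of_tendsto_of_tendsto hlim hlim2 ?_
  filter_upwards [eventually_gt_atTop |a|] with R hR
  have hR1 : a < R := (le_abs_self a).trans_lt hR
  have hR2 : -R < a := by linarith [neg_abs_le a]
  have key : ∀ p q : ℝ, p ≤ q → a ∉ Set.Ioo p q → ∫ v in p..q, φ v / (v - a) ≤ h q - h p := by
    intro p q hpq hna
    refine intervalIntegral.integral_le_sub_of_hasDeriv_right_of_le hpq hc.continuousOn
      (g' := fun v => (φ v * (v - a) - (f v - f a) * 1) / (v - a) ^ 2)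
      (fun v hv => (hderiv v ?_).hasDerivWithinAt) hi.integrableOn (fun v hv => hineq v ?_)
    all_goals
      rintro rfl
      exact hna hv
  have k1 := key (-R) a hR2.le (by simp)
  have k2 := key a R hR1.le (by simp)
  have : ∫ v in (-R)..R, φ v / (v - a)
      = (∫ v in (-R)..a, φ v / (v - a)) + ∫ v in a..R, φ v / (v - a) :=
    (intervalIntegral.integral_add_adjacent_intervals hi.intervalIntegrable
      hi.intervalIntegrable).symm
  simp only [id]
  linarith

lemma upper_bound {φ : ℝ → ℝ} (hint : Integrable φ) {a c b : ℝ} (hac : a < c) (hcb : c < b)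
    (hp1 : ∀ v : ℝ, v < a → 0 < φ v)
    (hp2 : ∀ v : ℝ, c < v → v < b → 0 < φ v)
    (hn1 : ∀ v : ℝ, a < v → v < c → φ v < 0)
    (hn2 : ∀ v : ℝ, b < v → φ v < 0) (hc0 : φ c = 0)
    (hi : Integrable (fun v => φ v / (v - c))) {z : ℂ} (hz : 0 < z.im) (him : (Zf φ z).im = 0) :
    (1 + ((c - a) * (b - c))⁻¹ * ((z.re - c) ^ 2 + z.im ^ 2)) * (Zf φ z).re
      ≤ ∫ v, φ v / (v - c) := by
  have hG : 0 < ((c - a) * (b - c))⁻¹ :=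
    inv_pos.2 (mul_pos (by linarith) (by linarith))
  have hG1 : ((c - a) * (b - c))⁻¹ * ((c - a) * (b - c)) = 1 :=
    inv_mul_cancel₀ (mul_pos (by linarith) (by linarith)).ne'
  rw [Zf_im hint hz] at him
  rw [Zf_re hint hz]
  have hir := re_integrable hint hz
  have hii := im_integrable hint hz
  set x := z.re
  set y := z.im
  set G := ((c - a) * (b - c))⁻¹
  set W := (x - c) ^ 2 + y ^ 2 with hW
  set B := 2 * (c - x) + W * G * (2 * c - a - b) with hB
  set C := ((1 + G * W) * (x - c) + B) / y with hC
  have hW0 : 0 ≤ W := by positivity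
  have e : (1 + G * W) * (∫ v : ℝ, φ v * (v - x) / ((v - x) ^ 2 + y ^ 2))
      = ∫ v : ℝ, ((1 + G * W) * (φ v * (v - x) / ((v - x) ^ 2 + y ^ 2))
        + C * (φ v * y / ((v - x) ^ 2 + y ^ 2))) := by
    rw [integral_add (hir.const_mul _) (hii.const_mul _), integral_const_mul, integral_const_mul,
      him]
    ring
  rw [e]
  apply integral_mono ((hir.const_mul _).add (hii.const_mul _)) hi
  intro v
  change (1 + G * W) * (φ v * (v - x) / ((v - x) ^ 2 + y ^ 2))
        + C * (φ v * y / ((v - x) ^ 2 + y ^ 2)) ≤ φ v / (v - c)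
  have hq : 0 < (v - x) ^ 2 + y ^ 2 := by positivity
  rcases eq_or_ne v c with rfl | hv
  · simp [hc0]
  have ht : v - c ≠ 0 := sub_ne_zero.2 hv
  have hP : 0 ≤ - (φ v * ((v - a) * (v - b)) / (v - c)) := by
    rw [← neg_div]
    rcases lt_trichotomy v a with h | h | h
    · have h1 := hp1 v h
      apply div_nonneg_of_nonpos _ (by linarith)
      have := mul_pos h1 (mul_pos_of_neg_of_neg (show v - a < 0 by linarith)
        (show v - b < 0 by linarith))
      linarith
    · simp [h]
    · rcases lt_or_gt_of_ne hv with h2 | h2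
      · have h1 := hn1 v h h2
        apply div_nonneg_of_nonpos _ (by linarith)
        have := mul_pos_of_neg_of_neg h1 (mul_neg_of_pos_of_neg (show 0 < v - a by linarith)
          (show v - b < 0 by linarith))
        linarith
      · apply div_nonneg _ (by linarith)
        rcases lt_trichotomy v b with h3 | h3 | h3
        · have h1 := hp2 v h2 h3
          have := mul_neg_of_pos_of_neg h1 (mul_neg_of_pos_of_neg (show 0 < v - a by linarith)
            (show v - b < 0 by linarith))
          linarith
        · simp [h3]
        · have h1 := hn2 v h3
          have := mul_neg_of_neg_of_pos h1 (mul_pos (show 0 < v - a by linarith)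
            (show 0 < v - b by linarith))
          linarith
  have hid : φ v / (v - c) = (1 + G * W) * (φ v * (v - x) / ((v - x) ^ 2 + y ^ 2))
        + C * (φ v * y / ((v - x) ^ 2 + y ^ 2))
        + W * G * (- (φ v * ((v - a) * (v - b)) / (v - c))) / ((v - x) ^ 2 + y ^ 2) := by
    have hy : y ≠ 0 := hz.ne'
    have e1 : C * (φ v * y / ((v - x) ^ 2 + y ^ 2))
      = ((1 + G * W) * (x - c) + B) * φ v / ((v - x) ^ 2 + y ^ 2) := by
      rw [hC]
      field_simp
    rw [e1]
    field_simp
    rw [hB]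
    have hG2 : G * (c - a) * (b - c) = 1 := by rw [← hG1]; ring
    rw [hW]
    linear_combination (-((x - c) ^ 2 + y ^ 2)) * φ v * hG2
  rw [hid]
  have : 0 ≤ W * G * (- (φ v * ((v - a) * (v - b)) / (v - c))) / ((v - x) ^ 2 + y ^ 2) := by
    positivity
  linarith

lemma landau_iff (φ : ℝ → ℝ) (k : ℝ) (hk : k ≠ 0) :
    (∃ l : ℂ, 0 < l.re ∧ Landau φ k l = 0) ↔ ∃ z : ℂ, 0 < z.im ∧ Zf φ z = (k : ℂ) ^ 2 := by
  have hkC : (k : ℂ) ≠ 0 := by exact_mod_cast hk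
  have hz0 : ∀ l : ℂ, Landau φ k l = 0 ↔ Zf φ (I * l / k) = (k : ℂ) ^ 2 := by
    intro l
    rw [Zf_landau φ k hk, sub_eq_zero, eq_comm, div_eq_one_iff_eq (pow_ne_zero 2 hkC)]
  have him : ∀ l : ℂ, (I * l / k).im = l.re / k := by
    intro l
    rw [Complex.div_ofReal_im]
    simp
  have hconj : ∀ z : ℂ, Zf φ z = (k : ℂ) ^ 2 → Zf φ ((starRingEnd ℂ) z) = (k : ℂ) ^ 2 := by
    intro z hz
    rw [Zf_conj, hz]
    simp
  constructor
  · rintro ⟨l, hl, h⟩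
    rw [hz0] at h
    rcases lt_or_gt_of_ne hk with hk' | hk'
    · refine ⟨_, ?_, hconj _ h⟩
      rw [Complex.conj_im, him]
      have := div_neg_of_pos_of_neg hl hk'
      linarith
    · refine ⟨_, ?_, h⟩
      rw [him]
      positivity
  · rintro ⟨z, hz, h⟩
    have hinv : ∀ w : ℂ, I * (-I * k * w) / k = w := by
      intro w
      field_simp
      ring_nf
      simp
    have hre : ∀ w : ℂ, (-I * k * w).re = k * w.im := by
      intro w
      simp
    rcases lt_or_gt_of_ne hk with hk' | hk'
    · refine ⟨-I * k * (starRingEnd ℂ) z, ?_, ?_⟩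
      · rw [hre, Complex.conj_im]
        nlinarith
      · rw [hz0, hinv]
        exact hconj z h
    · refine ⟨-I * k * z, ?_, ?_⟩
      · rw [hre]
        positivity
      · rw [hz0, hinv]
        exact h

/-- criterion of two-stream instability. In the two-stream
configuration, for `k ≠ 0` there is an unstable root `λ` (`Re λ > 0`, `Δ(k,λ) = 0`)
if and only if `∫ φ(v)/(v-c) dv > k²`. -/
theorem two_stream_instability_criterion (f₀ : ℝ → ℝ) (hf : ContDiff ℝ 1 f₀)
    (htop : Tendsto f₀ atTop (nhds 0)) (hbot : Tendsto f₀ atBot (nhds 0))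
    (φ : ℝ → ℝ) (hφ : φ = deriv f₀)
    (hint : Integrable φ)
    (hφd : Differentiable ℝ φ) (hφbd : ∃ M : ℝ, ∀ v : ℝ, |deriv φ v| ≤ M)
    (a c b : ℝ) (hac : a < c) (hcb : c < b)
    (hp1 : ∀ v : ℝ, v < a → 0 < φ v)
    (hp2 : ∀ v : ℝ, c < v → v < b → 0 < φ v)
    (hn1 : ∀ v : ℝ, a < v → v < c → φ v < 0)
    (hn2 : ∀ v : ℝ, b < v → φ v < 0)
    (heq : f₀ a = f₀ b) (hapos : 0 < f₀ a) (hc0 : f₀ c = 0)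
    (k : ℝ) (hk : k ≠ 0) :
    (∃ l : ℂ, 0 < l.re ∧ Landau φ k l = 0) ↔ k ^ 2 < ∫ v : ℝ, φ v / (v - c) := by
  have hd : ∀ v, HasDerivAt f₀ (φ v) v := by
    intro v
    rw [hφ]
    exact ((hf.differentiable one_ne_zero) v).hasDerivAt
  have hcont : Continuous φ := hφd.continuous
  obtain ⟨M, hM⟩ := hφbd
  have hL : ∀ u v, |φ u - φ v| ≤ M * |u - v| := by
    intro u v
    exact Convex.norm_image_sub_le_of_norm_deriv_le (s := Set.univ) (fun x _ => hφd x)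
      (fun x _ => hM x) convex_univ (Set.mem_univ v) (Set.mem_univ u)
  have hcf : Continuous f₀ := hf.continuous
  have hdf : Differentiable ℝ f₀ := hf.differentiable one_ne_zero
  have m1 : MonotoneOn f₀ (Set.Iic a) := by
    apply monotoneOn_of_deriv_nonneg (convex_Iic a) hcf.continuousOn hdf.differentiableOn
    intro v hv
    rw [interior_Iic] at hv
    rw [← hφ]
    exact (hp1 v hv).le
  have m2 : AntitoneOn f₀ (Set.Icc a c) := by
    apply antitoneOn_of_deriv_nonpos (convex_Icc a c) hcf.continuousOn hdf.differentiableOn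
    intro v hv
    rw [interior_Icc] at hv
    rw [← hφ]
    exact (hn1 v hv.1 hv.2).le
  have m3 : MonotoneOn f₀ (Set.Icc c b) := by
    apply monotoneOn_of_deriv_nonneg (convex_Icc c b) hcf.continuousOn hdf.differentiableOn
    intro v hv
    rw [interior_Icc] at hv
    rw [← hφ]
    exact (hp2 v hv.1 hv.2).le
  have m4 : AntitoneOn f₀ (Set.Ici b) := by
    apply antitoneOn_of_deriv_nonpos (convex_Ici b) hcf.continuousOn hdf.differentiableOn
    intro v hv
    rw [interior_Ici] at hv
    rw [← hφ]
    exact (hn2 v hv).le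
  have hmax : ∀ v, f₀ v ≤ f₀ a := by
    intro v
    rcases le_total v a with h | h
    · exact m1 h Set.self_mem_Iic h
    rcases le_total v c with h2 | h2
    · exact m2 ⟨le_rfl, hac.le⟩ ⟨h, h2⟩ h
    rw [heq]
    rcases le_total v b with h3 | h3
    · exact m3 ⟨h2, h3⟩ ⟨hcb.le, le_rfl⟩ h3
    · exact m4 Set.self_mem_Ici h3 h3
  have hφc : φ c = 0 := by
    rw [hφ]
    apply IsLocalMin.deriv_eq_zero
    filter_upwards [Ioo_mem_nhds hac hcb] with v hv
    rcases le_total v c with h2 | h2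
    · exact m2 ⟨hv.1.le, h2⟩ ⟨hac.le, le_rfl⟩ h2
    · exact m3 ⟨le_rfl, hcb.le⟩ ⟨h2, hv.2.le⟩ h2
  have hi := sing_integrable hint hcont hL c hφc
  have hub : ∀ z : ℂ, 0 < z.im → (Zf φ z).im = 0 → _ := fun z hz him =>
    upper_bound hint hac hcb hp1 hp2 hn1 hn2 hφc hi hz him
  have hA : ∫ v, φ v / (v - a) ≤ 0 ∨ φ a ≠ 0 := by
    by_cases h : φ a = 0
    · exact Or.inl (integral_nonpos_at_max hd htop hbot a hmax
        (sing_integrable hint hcont hL a h))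
    · exact Or.inr h
  have hB : ∫ v, φ v / (v - b) ≤ 0 ∨ φ b ≠ 0 := by
    by_cases h : φ b = 0
    · exact Or.inl (integral_nonpos_at_max hd htop hbot b (fun v => heq ▸ hmax v)
        (sing_integrable hint hcont hL b h))
    · exact Or.inr h
  have hk2 : 0 < k ^ 2 := by positivity
  have hkC : (k : ℂ) ≠ 0 := by exact_mod_cast hk
  rw [landau_iff φ k hk]
  constructor
  · rintro ⟨z, hz, hZ⟩
    have hre : (Zf φ z).re = k ^ 2 := by rw [hZ, ← Complex.ofReal_pow, Complex.ofReal_re]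
    have him : (Zf φ z).im = 0 := by rw [hZ, ← Complex.ofReal_pow, Complex.ofReal_im]
    have h := hub z hz him
    rw [hre] at h
    refine lt_of_lt_of_le ?_ h
    have : 0 < ((c - a) * (b - c))⁻¹ * ((z.re - c) ^ 2 + z.im ^ 2) := by
      have : 0 < (c - a) * (b - c) := mul_pos (by linarith) (by linarith)
      positivity
    nlinarith
  · intro hlt
    set Zc := ∫ v, φ v / (v - c) with hZc
    have hG : 0 < ((c - a) * (b - c))⁻¹ :=
      inv_pos.2 (mul_pos (by linarith) (by linarith))
    set G := ((c - a) * (b - c))⁻¹ with hGdef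
    let U : Set ℂ := {z : ℂ | 0 < z.im}
    have hUo : IsOpen U := isOpen_lt continuous_const Complex.continuous_im
    have hUc : IsPreconnected U := (convex_halfSpace_im_gt 0).isPreconnected
    have hdiff := Zf_differentiable hint
    have hZcont : ContinuousOn (Zf φ) U := hdiff.continuousOn
    let S : Set ℝ := {κ : ℝ | ∃ z : ℂ, 0 < z.im ∧ Zf φ z = (κ : ℂ)}
    -- a point near `c` with real value
    have hne : (Set.Ioo 0 Zc ∩ S).Nonempty := by
      have hpos := (re_tendsto hint hcont hL c hφc).eventually_const_lt (hk2.trans hlt)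
      rw [eventually_nhdsWithin_iff] at hpos
      obtain ⟨δ, hδ, hball⟩ := Metric.eventually_nhds_iff.1 hpos
      obtain ⟨r, hr0, hr1⟩ : ∃ r : ℝ, 0 < r ∧ r < min δ (min (c - a) (b - c)) :=
        exists_between (lt_min hδ (lt_min (by linarith) (by linarith)))
      have hrδ : r < δ := hr1.trans_le (min_le_left _ _)
      have hra : r < c - a := hr1.trans_le ((min_le_right _ _).trans (min_le_left _ _))
      have hrb : r < b - c := hr1.trans_le ((min_le_right _ _).trans (min_le_right _ _))
      let γ : ℝ → ℂ := fun θ => ((c + r * Real.cos θ : ℝ) : ℂ) + ((r * Real.sin θ : ℝ) : ℂ) * I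
      have hγim : ∀ θ, (γ θ).im = r * Real.sin θ := by
        intro θ
        simp [γ, -Complex.ofReal_add, -Complex.ofReal_mul, -Complex.ofReal_cos, -Complex.ofReal_sin]
      have hγre : ∀ θ, (γ θ).re = c + r * Real.cos θ := by
        intro θ
        simp [γ, -Complex.ofReal_add, -Complex.ofReal_mul, -Complex.ofReal_cos, -Complex.ofReal_sin]
      have hγU : ∀ θ ∈ Set.Ioo 0 Real.pi, γ θ ∈ U := by
        intro θ hθ
        change 0 < (γ θ).im
        rw [hγim]
        exact mul_pos hr0 (Real.sin_pos_of_pos_of_lt_pi hθ.1 hθ.2)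
      have hγc : Continuous γ := by
        have h1 : Continuous (fun θ : ℝ => c + r * Real.cos θ) := by fun_prop
        have h2 : Continuous (fun θ : ℝ => r * Real.sin θ) := by fun_prop
        exact (Complex.continuous_ofReal.comp h1).add
          ((Complex.continuous_ofReal.comp h2).mul continuous_const)
      have hγ0 : γ 0 = ((c + r : ℝ) : ℂ) := by simp [γ]
      have hγπ : γ Real.pi = ((c - r : ℝ) : ℂ) := by
        simp [γ]
        ring
      have t0 : Tendsto γ (nhdsWithin 0 (Set.Ioo 0 Real.pi)) (nhdsWithin ((c + r : ℝ) : ℂ) U) := by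
        apply tendsto_nhdsWithin_of_tendsto_nhds_of_eventually_within
        · rw [← hγ0]
          exact hγc.continuousAt.tendsto.mono_left nhdsWithin_le_nhds
        · filter_upwards [self_mem_nhdsWithin] with θ hθ
          exact hγU θ hθ
      have tπ : Tendsto γ (nhdsWithin Real.pi (Set.Ioo 0 Real.pi))
          (nhdsWithin ((c - r : ℝ) : ℂ) U) := by
        apply tendsto_nhdsWithin_of_tendsto_nhds_of_eventually_within
        · rw [← hγπ]
          exact hγc.continuousAt.tendsto.mono_left nhdsWithin_le_nhds
        · filter_upwards [self_mem_nhdsWithin] with θ hθ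
          exact hγU θ hθ
      have n0 : (nhdsWithin (0 : ℝ) (Set.Ioo 0 Real.pi)).NeBot :=
        left_nhdsWithin_Ioo_neBot Real.pi_pos
      have nπ : (nhdsWithin Real.pi (Set.Ioo 0 Real.pi)).NeBot :=
        right_nhdsWithin_Ioo_neBot Real.pi_pos
      obtain ⟨θ₁, hθ₁, hθ₁m⟩ := ((t0.eventually (im_pos_near hint hcont (c + r)
        (hp2 _ (by linarith) (by linarith)))).and self_mem_nhdsWithin).exists
      obtain ⟨θ₂, hθ₂, hθ₂m⟩ := ((tπ.eventually (im_pos_near hint.neg hcont.neg (c - r)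
        (by
          have := hn1 (c - r) (by linarith) (by linarith)
          simpa using this))).and self_mem_nhdsWithin).exists
      have hθ₂' : (Zf φ (γ θ₂)).im < 0 := by
        have h1 : Zf (-φ) (γ θ₂) = - Zf φ (γ θ₂) := Zf_neg φ _
        rw [h1] at hθ₂
        simpa using hθ₂
      have hcon : ContinuousOn (fun θ => (Zf φ (γ θ)).im) (Set.Ioo 0 Real.pi) :=
        Complex.continuous_im.comp_continuousOn (hZcont.comp hγc.continuousOn hγU)
      obtain ⟨θ, hθ, hθ0⟩ := (isPreconnected_Ioo (a := (0 : ℝ)) (b := Real.pi)).intermediate_value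
        hθ₂m hθ₁m hcon ⟨hθ₂'.le, hθ₁.le⟩
      have hzU : 0 < (γ θ).im := hγU θ hθ
      have hdist : dist (γ θ) (c : ℂ) < δ := by
        rw [Complex.dist_eq_re_im, hγre, hγim]
        have : (c + r * Real.cos θ - (c : ℂ).re) ^ 2 + (r * Real.sin θ - (c : ℂ).im) ^ 2 = r ^ 2 := by
          simp
          nlinarith [Real.sin_sq_add_cos_sq θ]
        rw [this, Real.sqrt_sq hr0.le]
        exact hrδ
      have hre0 := hball hdist hzU
      have hu := hub (γ θ) hzU hθ0
      refine ⟨(Zf φ (γ θ)).re, ⟨hre0, lt_of_lt_of_le ?_ hu⟩, γ θ, hzU, ?_⟩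
      · have : 0 < G * (((γ θ).re - c) ^ 2 + (γ θ).im ^ 2) := by positivity
        nlinarith
      · apply Complex.ext
        · simp
        · simpa using hθ0
    have hSo : IsOpen S := by
      rcases (hdiff.analyticOnNhd hUo).is_constant_or_isOpen hUc with ⟨w, hw⟩ | ho
      · exfalso
        obtain ⟨κ, hκ, z, hz, hzκ⟩ := hne
        have hwκ : w = κ := by rw [← hzκ, hw z hz]
        let z' : ℂ := ((Zc / (G * κ) + 1 : ℝ) : ℂ) * I
        have hGκ : 0 < G * κ := mul_pos hG hκ.1
        have hZc0 : 0 < Zc := hκ.1.trans hκ.2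
        have hz'im : z'.im = Zc / (G * κ) + 1 := by
          simp [z', -Complex.ofReal_add, -Complex.ofReal_div]
        have hz' : 0 < z'.im := by
          rw [hz'im]
          positivity
        have hv : Zf φ z' = κ := by rw [hw z' hz', hwκ]
        have h := hub z' hz' (by rw [hv]; simp)
        rw [hv, hz'im] at h
        simp only [Complex.ofReal_re] at h
        set T := Zc / (G * κ) with hT
        have hT0 : 0 < T := by positivity
        have hTe : T * (G * κ) = Zc := by rw [hT]; exact div_mul_cancel₀ _ hGκ.ne'
        have h2 : 0 ≤ (G * κ) * (z'.re - c) ^ 2 := by positivity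
        have h3 : 0 < (G * κ) * (T ^ 2 + T + 1) := by positivity
        nlinarith [hκ.1]
      · have h1 := ho U subset_rfl hUo
        have h2 : S = (fun κ : ℝ => (κ : ℂ)) ⁻¹' (Zf φ '' U) := by
          ext κ
          rfl
        rw [h2]
        exact h1.preimage Complex.continuous_ofReal
    have hcl : closure S ∩ Set.Ioo 0 Zc ⊆ S := by
      rintro κ ⟨hκcl, hκ0, hκZ⟩
      obtain ⟨κn, hκn, hlim⟩ := mem_closure_iff_seq_limit.1 hκcl
      choose zn hznim hzn using hκn
      have him0 : ∀ n, (Zf φ (zn n)).im = 0 := fun n => by rw [hzn]; simp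
      have hre0 : ∀ n, (Zf φ (zn n)).re = κn n := fun n => by rw [hzn]; simp
      have hev : ∀ᶠ n in atTop, zn n ∈ Metric.closedBall (c : ℂ) (Real.sqrt (2 * Zc / (G * κ))) := by
        filter_upwards [hlim.eventually_const_lt (show κ / 2 < κ by linarith)] with n hn
        have h := hub (zn n) (hznim n) (him0 n)
        rw [hre0] at h
        rw [Metric.mem_closedBall, Complex.dist_eq_re_im]
        apply Real.sqrt_le_sqrt
        simp only [Complex.ofReal_re, Complex.ofReal_im, sub_zero]
        rw [le_div_iff₀ (mul_pos hG hκ0)]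
        set W := ((zn n).re - c) ^ 2 + (zn n).im ^ 2
        have hW : 0 ≤ W := by positivity
        have : 0 ≤ G * W := by positivity
        nlinarith
      obtain ⟨zs, -, ψ, hψ, hzs⟩ :=
        tendsto_subseq_of_frequently_bounded Metric.isBounded_closedBall hev.frequently
      have hκs : Tendsto (fun n => κn (ψ n)) atTop (nhds κ) := hlim.comp hψ.tendsto_atTop
      have hims : 0 ≤ zs.im :=
        ge_of_tendsto' ((Complex.continuous_im.tendsto zs).comp hzs) (fun n => (hznim (ψ n)).le)
      rcases hims.lt_or_eq with hpos | hzero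
      · refine ⟨zs, hpos, ?_⟩
        have h1 : Tendsto (fun n => Zf φ (zn (ψ n))) atTop (nhds (Zf φ zs)) :=
          ((hZcont.continuousAt (hUo.mem_nhds hpos)).tendsto).comp hzs
        have h2 : Tendsto (fun n => Zf φ (zn (ψ n))) atTop (nhds (κ : ℂ)) := by
          simp only [hzn]
          exact (Complex.continuous_ofReal.tendsto κ).comp hκs
        exact tendsto_nhds_unique h1 h2
      · exfalso
        obtain ⟨x₀, rfl⟩ : ∃ x₀ : ℝ, zs = (x₀ : ℂ) :=
          ⟨zs.re, Complex.ext (by simp) (by simp [← hzero])⟩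
        have hw : Tendsto (fun n => zn (ψ n)) atTop (nhdsWithin (x₀ : ℂ) {z : ℂ | 0 < z.im}) :=
          tendsto_nhdsWithin_of_tendsto_nhds_of_eventually_within _ hzs
            (Eventually.of_forall fun n => hznim (ψ n))
        rcases lt_trichotomy (φ x₀) 0 with h | h | h
        · obtain ⟨n, hn⟩ := (hw.eventually (im_pos_near hint.neg hcont.neg x₀
            (by simpa using h))).exists
          have h1 : Zf (-φ) (zn (ψ n)) = - Zf φ (zn (ψ n)) := Zf_neg φ _
          rw [h1, Complex.neg_im, him0] at hn
          simp at hn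
        · have h1 := (re_tendsto hint hcont hL x₀ h).comp hw
          have h2 : Tendsto (fun n => κn (ψ n)) atTop (nhds (∫ v, φ v / (v - x₀))) := by
            refine h1.congr fun n => ?_
            exact hre0 _
          have h3 := tendsto_nhds_unique hκs h2
          rcases lt_trichotomy x₀ a with g | g | g
          · linarith [hp1 _ g]
          · subst g
            rcases hA with hA | hA
            · linarith
            · exact hA h
          rcases lt_trichotomy x₀ c with g2 | g2 | g2
          · linarith [hn1 _ g g2]
          · subst g2
            linarith
          rcases lt_trichotomy x₀ b with g3 | g3 | g3
          · linarith [hp2 _ g2 g3]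
          · subst g3
            rcases hB with hB | hB
            · linarith
            · exact hB h
          · linarith [hn2 _ g3]
        · obtain ⟨n, hn⟩ := (hw.eventually (im_pos_near hint hcont x₀ h)).exists
          rw [him0] at hn
          exact lt_irrefl _ hn
    have hfin := isPreconnected_Ioo.subset_of_closure_inter_subset hSo hne hcl
    obtain ⟨z, hz, hzk⟩ := hfin ⟨hk2, hlt⟩
    exact ⟨z, hz, by rw [hzk]; push_cast; rfl⟩
end
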